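/- Let M ≥ 0, let h ≥ 0 be an integer, and let A_N, B_N be (M,h)-regular sequences of normal matrices with limit moments Φ = (φ_k) and Ψ = (ψ_k) respectively. For each N, let F_N be a free-energy branch for I_N(·;A_N,B_N) on some disc around 0. Then for every fixed integer d ≥ 1, N^{2h}·(F_N^{(d)}(0) − Σ_{g=0}^{h} C_{g,d}(Φ,Ψ)/N^{2g}) → 0 as N → ∞. -/

import Mathlib

open MeasureTheory Matrix

namespace HCIZ

noncomputable instance (N : ℕ) : MeasurableSpace (Matrix (Fin N) (Fin N) ℂ) := borel _

instance (N : ℕ) : BorelSpace (Matrix (Fin N) (Fin N) ℂ) := ⟨rfl⟩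

/-- The number of cycles of a permutation (fixed points counted as cycles). -/
def cycleCount {d : ℕ} (π : Equiv.Perm (Fin d)) : ℕ := π.partition.parts.card

/-- `π` has cycle type `α` (1-cycles included). -/
def HasCycleType {d : ℕ} (π : Equiv.Perm (Fin d)) (α : d.Partition) : Prop :=
  π.partition.parts = α.parts

/-- The tuple `τ` consists of transpositions `(s_i t_i)`, `s_i < t_i`, with
`t_1 ≤ t_2 ≤ ⋯` (monotone condition). -/
def IsMonotoneTuple {d r : ℕ} (τ : Fin r → Equiv.Perm (Fin d)) : Prop :=
  (∀ i, (τ i).IsSwap) ∧ Monotone fun i => (τ i).support.max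

/-- The subgroup generated by `s` acts transitively on `Fin d`. -/
def GeneratesTransitively {d : ℕ} (s : Set (Equiv.Perm (Fin d))) : Prop :=
  ∀ x y : Fin d, ∃ g ∈ Subgroup.closure s, g x = y

/-- `H⃗^r(α,β)`: the number of monotone transitive factorizations of the identity
into `ρ σ τ_1 ⋯ τ_r` with `ρ` of cycle type `α` and `σ` of cycle type `β`. -/
noncomputable def Hr (d : ℕ) (α β : d.Partition) (r : ℕ) : ℕ :=
  Nat.card {T : Equiv.Perm (Fin d) × Equiv.Perm (Fin d) × (Fin r → Equiv.Perm (Fin d)) //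
    HasCycleType T.1 α ∧ HasCycleType T.2.1 β ∧ IsMonotoneTuple T.2.2 ∧
    T.1 * T.2.1 * (List.ofFn T.2.2).prod = 1 ∧
    GeneratesTransitively ({T.1, T.2.1} ∪ Set.range T.2.2)}

/-- `H̃^r(α,β)`: the same count without the transitivity requirement. -/
noncomputable def Hnt (d : ℕ) (α β : d.Partition) (r : ℕ) : ℕ :=
  Nat.card {T : Equiv.Perm (Fin d) × Equiv.Perm (Fin d) × (Fin r → Equiv.Perm (Fin d)) //
    HasCycleType T.1 α ∧ HasCycleType T.2.1 β ∧ IsMonotoneTuple T.2.2 ∧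
    T.1 * T.2.1 * (List.ofFn T.2.2).prod = 1}

/-- The monotone double Hurwitz number `H⃗_g(α,β) = H⃗^r(α,β)`,
`r = 2g - 2 + ℓ(α) + ℓ(β)`. -/
noncomputable def Hg (d g : ℕ) (α β : d.Partition) : ℕ :=
  Hr d α β (2 * g + α.parts.card + β.parts.card - 2)

/-- `m_r(π)`: monotone (not necessarily transitive) factorizations of `π`
into `r` transpositions. -/
noncomputable def mcount (d r : ℕ) (π : Equiv.Perm (Fin d)) : ℕ :=
  Nat.card {τ : Fin r → Equiv.Perm (Fin d) //
    IsMonotoneTuple τ ∧ (List.ofFn τ).prod = π}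

/-- Power sum `p_α(A) = ∏ Tr(A^{α_i})`. -/
noncomputable def pPoly {N : ℕ} (A : Matrix (Fin N) (Fin N) ℂ) {d : ℕ} (α : d.Partition) : ℂ :=
  (α.parts.map fun k => (A ^ k).trace).prod

/-- `φ_α = ∏ φ_{α_i}`. -/
noncomputable def momProd (Φ : ℕ → ℂ) {d : ℕ} (α : d.Partition) : ℂ :=
  (α.parts.map Φ).prod

/-- `C_{g,d}(A,B) = ∑_{α,β ⊢ d} (-1)^{d+ℓ(α)+ℓ(β)} H⃗_g(α,β)
(N^{-ℓ(α)} p_α(A)) (N^{-ℓ(β)} p_β(B))`. -/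
noncomputable def Cmat {N : ℕ} (g d : ℕ) (A B : Matrix (Fin N) (Fin N) ℂ) : ℂ :=
  ∑ α : d.Partition, ∑ β : d.Partition,
    (-1 : ℂ) ^ (d + α.parts.card + β.parts.card) * (Hg d g α β : ℂ) *
      (((N : ℂ) ^ α.parts.card)⁻¹ * pPoly A α) * (((N : ℂ) ^ β.parts.card)⁻¹ * pPoly B β)

/-- `C_{g,d}(Φ,Ψ) = ∑_{α,β ⊢ d} (-1)^{d+ℓ(α)+ℓ(β)} H⃗_g(α,β) φ_α ψ_β`. -/
noncomputable def Cseq (g d : ℕ) (Φ Ψ : ℕ → ℂ) : ℂ :=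
  ∑ α : d.Partition, ∑ β : d.Partition,
    (-1 : ℂ) ^ (d + α.parts.card + β.parts.card) * (Hg d g α β : ℂ) *
      momProd Φ α * momProd Ψ β

/-- The HCIZ integral `I_N(z;A,B)` with respect to a measure `μ` on `U(N)`. -/
noncomputable def hciz {N : ℕ} (μ : Measure (Matrix.unitaryGroup (Fin N) ℂ))
    (A B : Matrix (Fin N) (Fin N) ℂ) (z : ℂ) : ℂ :=
  ∫ U : Matrix.unitaryGroup (Fin N) ℂ,
    Complex.exp (-(z * (N : ℂ) *
      (A * (U : Matrix (Fin N) (Fin N) ℂ) * B *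
        ((U⁻¹ : Matrix.unitaryGroup (Fin N) ℂ) : Matrix (Fin N) (Fin N) ℂ)).trace)) ∂μ

/-- A free-energy branch for `I_N(·;A,B)` on the disc `D(0,ε)`: a holomorphic
function `F` with `F 0 = 0` and `exp (N² F z) = I_N(z;A,B)` on the disc. -/
def IsFreeEnergyBranch {N : ℕ} (μ : Measure (Matrix.unitaryGroup (Fin N) ℂ))
    (A B : Matrix (Fin N) (Fin N) ℂ) (ε : ℝ) (F : ℂ → ℂ) : Prop :=
  DifferentiableOn ℂ F (Metric.ball 0 ε) ∧ F 0 = 0 ∧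
    ∀ z ∈ Metric.ball (0 : ℂ) ε, Complex.exp ((N : ℂ) ^ 2 * F z) = hciz μ A B z

/-- The L² operator norm of a matrix. -/
noncomputable def opNorm {N : ℕ} (A : Matrix (Fin N) (Fin N) ℂ) : ℝ :=
  ‖Matrix.toEuclideanCLM (𝕜 := ℂ) A‖

/-- The all-ones partition `(1^d)`. -/
def onesPartition (d : ℕ) : d.Partition :=
  ⟨Multiset.replicate d 1, fun {i} hi => by
    rw [Multiset.eq_of_mem_replicate hi]; exact one_pos, by simp⟩

/-- The partition `(2,1^{d-2})` of `d`, for `d ≥ 2`. -/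
def twoOnesPartition (d : ℕ) (hd : 2 ≤ d) : d.Partition :=
  ⟨2 ::ₘ Multiset.replicate (d - 2) 1, fun {i} hi => by
    rcases Multiset.mem_cons.mp hi with h | h
    · omega
    · rw [Multiset.eq_of_mem_replicate h]; exact one_pos, by
    simp [Multiset.sum_cons]; omega⟩

/-- The product of the transpositions listed in `L`. -/
def swapProd {α : Type} [DecidableEq α] (L : List (α × α)) : Equiv.Perm α :=
  (L.map fun q => Equiv.swap q.1 q.2).prod

/-- A list of pairs is a monotone word for the key `κ` if each pair is increasing and the
larger entries are weakly increasing along the list. -/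
def IsWord {α : Type} (κ : α → ℕ) (L : List (α × α)) : Prop :=
  (∀ q ∈ L, κ q.1 < κ q.2) ∧ L.Pairwise fun a b => κ a.2 ≤ κ b.2

/-- The type of monotone words. -/
abbrev Word {α : Type} (κ : α → ℕ) : Type := {L : List (α × α) // IsWord κ L}

/-- The set `S` is preserved by `σ` and by all the transpositions listed in `L`. -/
def Preserves {α : Type} (σ : Equiv.Perm α) (L : List (α × α)) (S : Set α) : Prop :=
  (∀ a, σ a ∈ S ↔ a ∈ S) ∧ ∀ q ∈ L, q.1 ∈ S ↔ q.2 ∈ S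

/-- The permutation `σ` and the transpositions in `L` act transitively. -/
def IsConn {α : Type} (σ : Equiv.Perm α) (L : List (α × α)) : Prop :=
  ∀ S : Set α, Preserves σ L S → S.Nonempty → S = Set.univ

/-- The trace of the tensor product of the `M k` composed with the permutation `σ`. -/
noncomputable def permSum {α n : Type} [Fintype α] [Fintype n] [DecidableEq α]
    (M : α → Matrix n n ℂ) (σ : Equiv.Perm α) : ℂ :=
  ∑ i : α → n, ∏ k, M k (i k) (i (σ k))

lemma permSum_reindex {α β n : Type} [Fintype α] [Fintype β] [Fintype n] [DecidableEq α]
    [DecidableEq β] (e : α ≃ β) (M : β → Matrix n n ℂ) (σ : Equiv.Perm α) :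
    permSum M (e.permCongr σ) = permSum (M ∘ e) σ := by
  unfold permSum
  rw [← (e.arrowCongr (Equiv.refl n)).sum_comp]
  refine Finset.sum_congr rfl fun i _ => ?_
  rw [← e.prod_comp]
  simp

lemma permSum_subtypeCongr {α n : Type} [Fintype α] [Fintype n] [DecidableEq α]
    (p : α → Prop) [DecidablePred p] [i₁ : Fintype {a // p a}]
    [i₂ : Fintype {a // ¬ p a}] (M : α → Matrix n n ℂ)
    (σ : Equiv.Perm {a // p a}) (τ : Equiv.Perm {a // ¬ p a}) :
    permSum M (σ.subtypeCongr τ) =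
      permSum (fun a : {a // p a} => M a) σ * permSum (fun a : {a // ¬ p a} => M a) τ := by
  obtain rfl : i₁ = Subtype.fintype p := Subsingleton.elim _ _
  obtain rfl : i₂ = Subtype.fintype fun a => ¬ p a := Subsingleton.elim _ _
  unfold permSum
  rw [Finset.sum_mul_sum, ← Finset.sum_product', Finset.univ_product_univ,
    ← (Equiv.piEquivPiSubtypeProd p fun _ => n).sum_comp]
  refine Finset.sum_congr rfl fun i _ => ?_
  rw [← Fintype.prod_subtype_mul_prod_subtype p]
  congr 1
  · refine Finset.prod_congr rfl fun k _ => ?_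
    simp [Equiv.Perm.subtypeCongr.left_apply _ _ k.2]
  · refine Finset.prod_congr rfl fun k _ => ?_
    simp [Equiv.Perm.subtypeCongr.right_apply _ _ k.2]

lemma summable_list_pow {β : Type} [Fintype β] (y : ℝ) (h0 : 0 ≤ y)
    (hy : (Fintype.card β : ℝ) * y < 1) : Summable fun L : List β => y ^ L.length := by
  rw [← (Equiv.sigmaFiberEquiv (List.length : List β → ℕ)).summable_iff]
  have key : ∀ n : ℕ, Nat.card {L : List β // L.length = n} = Fintype.card β ^ n := fun n => by
    change Nat.card (List.Vector β n) = _
    rw [Nat.card_eq_fintype_card, card_vector]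
  have fin : ∀ n : ℕ, Finite {L : List β // L.length = n} := fun n =>
    inferInstanceAs (Finite (List.Vector β n))
  have e : ((fun L : List β => y ^ L.length) ∘ (Equiv.sigmaFiberEquiv (List.length : List β → ℕ)))
      = fun q => y ^ q.1 := by
    ext ⟨n, L, hL⟩
    simp [Equiv.sigmaFiberEquiv, hL]
  rw [e, summable_sigma_of_nonneg fun _ => by positivity]
  refine ⟨fun n => by simpa using Summable.of_finite, ?_⟩
  have : (fun n : ℕ => ∑' _ : {L : List β // L.length = n}, y ^ n)
      = fun n => ((Fintype.card β : ℝ) * y) ^ n := by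
    ext n
    rw [tsum_const, key, nsmul_eq_mul, mul_pow]
    push_cast
    rfl
  rw [this]
  exact summable_geometric_of_lt_one (by positivity) hy

lemma filter_merge_left {γ : Type} (le : γ → γ → Bool) (P : γ → Bool) (l₁ l₂ : List γ)
    (h₁ : ∀ a ∈ l₁, P a = true) (h₂ : ∀ a ∈ l₂, P a = false) :
    (l₁.merge l₂ le).filter P = l₁ := by
  induction l₁ generalizing l₂ with
  | nil => simpa using h₂
  | cons a l₁ ih₁ =>
    induction l₂ with
    | nil => simpa using h₁
    | cons b l₂ ih₂ =>
      rw [List.cons_merge_cons]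
      split_ifs with h
      · rw [List.filter_cons_of_pos (h₁ a (by simp)), ih₁ _ (fun x hx => h₁ x (by simp [hx])) h₂]
      · rw [List.filter_cons_of_neg (by simp [h₂ b (by simp)])]
        exact ih₂ fun x hx => h₂ x (by simp [hx])

lemma filter_merge_right {γ : Type} (le : γ → γ → Bool) (P : γ → Bool) (l₁ l₂ : List γ)
    (h₁ : ∀ a ∈ l₁, P a = false) (h₂ : ∀ a ∈ l₂, P a = true) :
    (l₁.merge l₂ le).filter P = l₂ := by
  induction l₁ generalizing l₂ with
  | nil => simpa using h₂
  | cons a l₁ ih₁ =>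
    induction l₂ with
    | nil => simpa using h₁
    | cons b l₂ ih₂ =>
      rw [List.cons_merge_cons]
      split_ifs with h
      · rw [List.filter_cons_of_neg (by simp [h₁ a (by simp)])]
        exact ih₁ _ (fun x hx => h₁ x (by simp [hx])) h₂
      · rw [List.filter_cons_of_pos (h₂ b (by simp)), ih₂ fun x hx => h₂ x (by simp [hx])]

lemma merge_cons_left {γ : Type} (le : γ → γ → Bool) (a : γ) (l₁ l₂ : List γ)
    (h : ∀ b ∈ l₂, le a b = true) : (a :: l₁).merge l₂ le = a :: l₁.merge l₂ le := by
  cases l₂ with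
  | nil => simp
  | cons b l₂ => rw [List.cons_merge_cons, if_pos (h b (by simp))]

lemma merge_cons_right {γ : Type} (le : γ → γ → Bool) (b : γ) (l₁ l₂ : List γ)
    (h : ∀ a ∈ l₁, le a b = false) : l₁.merge (b :: l₂) le = b :: l₁.merge l₂ le := by
  cases l₁ with
  | nil => simp
  | cons a l₁ => rw [List.cons_merge_cons, if_neg (by simp [h a (by simp)])]

lemma merge_filter {γ : Type} (k : γ → ℕ) (P : γ → Bool) (l : List γ)
    (hl : l.Pairwise fun a b => k a ≤ k b)
    (hk : ∀ a b, P a = true → P b = false → k a ≠ k b) :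
    (l.filter P).merge (l.filter fun a => !P a) (fun a b => decide (k a ≤ k b)) = l := by
  induction l with
  | nil => simp
  | cons a l ih =>
    rw [List.pairwise_cons] at hl
    cases h : P a with
    | true =>
      rw [List.filter_cons_of_pos h, List.filter_cons_of_neg (by simp [h]), merge_cons_left,
        ih hl.2]
      intro b hb
      simpa using hl.1 b (List.mem_of_mem_filter hb)
    | false =>
      rw [List.filter_cons_of_neg (by simp [h]), List.filter_cons_of_pos (by simp [h]),
        merge_cons_right, ih hl.2]
      intro b hb
      rw [List.mem_filter] at hb
      have h1 := hl.1 b hb.1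
      have h2 := hk b a hb.2 h
      simp only [decide_eq_false_iff_not]
      omega

section GlueWords

variable {α : Type} (p : α → Prop) (κ : α → ℕ)

/-- Merge a list of pairs in `p` and a list of pairs outside `p` according to the key. -/
def glueList (L₁ : List ({a // p a} × {a // p a})) (L₂ : List ({a // ¬ p a} × {a // ¬ p a})) :
    List (α × α) :=
  (L₁.map (Prod.map Subtype.val Subtype.val)).merge (L₂.map (Prod.map Subtype.val Subtype.val))
    (fun a b => decide (κ a.2 ≤ κ b.2))

lemma glueList_perm (L₁ : List ({a // p a} × {a // p a}))
    (L₂ : List ({a // ¬ p a} × {a // ¬ p a})) :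
    (glueList p κ L₁ L₂).Perm (L₁.map (Prod.map Subtype.val Subtype.val) ++
      L₂.map (Prod.map Subtype.val Subtype.val)) :=
  List.merge_perm_append _

lemma mem_glueList (L₁ : List ({a // p a} × {a // p a}))
    (L₂ : List ({a // ¬ p a} × {a // ¬ p a})) (q : α × α) :
    q ∈ glueList p κ L₁ L₂ ↔ (∃ r ∈ L₁, (↑r.1, ↑r.2) = q) ∨ ∃ r ∈ L₂, (↑r.1, ↑r.2) = q := by
  rw [(glueList_perm p κ L₁ L₂).mem_iff]
  simp only [List.mem_append, List.mem_map]
  rfl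

lemma length_glueList (L₁ : List ({a // p a} × {a // p a}))
    (L₂ : List ({a // ¬ p a} × {a // ¬ p a})) :
    (glueList p κ L₁ L₂).length = L₁.length + L₂.length := by
  rw [(glueList_perm p κ L₁ L₂).length_eq]; simp

lemma isWord_glueList {L₁ : List ({a // p a} × {a // p a})}
    {L₂ : List ({a // ¬ p a} × {a // ¬ p a})}
    (h₁ : IsWord (fun a : {a // p a} => κ a) L₁) (h₂ : IsWord (fun a : {a // ¬ p a} => κ a) L₂) :
    IsWord κ (glueList p κ L₁ L₂) := by
  constructor
  · intro q hq
    rcases (mem_glueList p κ L₁ L₂ q).1 hq with ⟨r, hr, rfl⟩ | ⟨r, hr, rfl⟩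
    · exact h₁.1 r hr
    · exact h₂.1 r hr
  · have := List.pairwise_merge (le := fun a b : α × α => decide (κ a.2 ≤ κ b.2))
      (l₁ := L₁.map (Prod.map Subtype.val Subtype.val))
      (l₂ := L₂.map (Prod.map Subtype.val Subtype.val))
      (by intro a b c; simp; omega) (by intro a b; simp; omega)
      (by rw [List.pairwise_map]; simpa using h₁.2) (by rw [List.pairwise_map]; simpa using h₂.2)
    simpa [glueList] using this

variable [DecidablePred p]

lemma swapProd_glueList [DecidableEq α] (L₁ : List ({a // p a} × {a // p a}))
    (L₂ : List ({a // ¬ p a} × {a // ¬ p a})) :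
    swapProd (glueList p κ L₁ L₂) = (swapProd L₁).subtypeCongr (swapProd L₂) := by
  have hl : ∀ a b : {a // p a}, Equiv.swap (a : α) b =
      Equiv.Perm.subtypeCongrHom p (Equiv.swap a b, 1) := by
    intro a b
    ext x
    by_cases hx : p x
    · rw [Equiv.Perm.subtypeCongrHom_apply, Equiv.Perm.subtypeCongr.left_apply _ _ hx]
      simp only [Equiv.swap_apply_def, Subtype.ext_iff]
      split_ifs <;> rfl
    · rw [Equiv.Perm.subtypeCongrHom_apply, Equiv.Perm.subtypeCongr.right_apply _ _ hx,
        Equiv.swap_apply_of_ne_of_ne]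
      · rfl
      · rintro rfl; exact hx a.2
      · rintro rfl; exact hx b.2
  have hr : ∀ a b : {a // ¬ p a}, Equiv.swap (a : α) b =
      Equiv.Perm.subtypeCongrHom p (1, Equiv.swap a b) := by
    intro a b
    ext x
    by_cases hx : p x
    · rw [Equiv.Perm.subtypeCongrHom_apply, Equiv.Perm.subtypeCongr.left_apply _ _ hx,
        Equiv.swap_apply_of_ne_of_ne]
      · rfl
      · rintro rfl; exact a.2 hx
      · rintro rfl; exact b.2 hx
    · rw [Equiv.Perm.subtypeCongrHom_apply, Equiv.Perm.subtypeCongr.right_apply _ _ hx]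
      simp only [Equiv.swap_apply_def, Subtype.ext_iff]
      split_ifs <;> rfl
  have key : ∀ L₁ L₂, swapProd (glueList p κ L₁ L₂) =
      Equiv.Perm.subtypeCongrHom p (swapProd L₁, swapProd L₂) := by
    intro L₁
    induction L₁ with
    | nil =>
      intro L₂
      induction L₂ with
      | nil =>
        rw [show glueList p κ [] [] = [] by simp [glueList]]
        exact (map_one (Equiv.Perm.subtypeCongrHom p)).symm
      | cons b L₂ ih =>
        have e : ((swapProd ([] : List ({a // p a} × {a // p a})), swapProd (b :: L₂)) :
            Equiv.Perm {a // p a} × Equiv.Perm {a // ¬ p a}) =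
            (1, Equiv.swap b.1 b.2) * (swapProd [], swapProd L₂) := by simp [swapProd]
        rw [e, map_mul, ← hr, ← ih]
        simp [glueList, swapProd]
    | cons a L₁ ih₁ =>
      have ea : ∀ L₂, ((swapProd (a :: L₁), swapProd L₂) :
          Equiv.Perm {a // p a} × Equiv.Perm {a // ¬ p a}) =
          (Equiv.swap a.1 a.2, 1) * (swapProd L₁, swapProd L₂) := by simp [swapProd]
      intro L₂
      induction L₂ with
      | nil =>
        rw [ea, map_mul, ← hl, ← ih₁]
        simp [glueList, swapProd]
      | cons b L₂ ih =>
        by_cases h : κ a.2 ≤ κ b.2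
        · rw [ea, map_mul, ← hl, ← ih₁]
          simp [glueList, swapProd, h]
        · have e : ((swapProd (a :: L₁), swapProd (b :: L₂)) :
              Equiv.Perm {a // p a} × Equiv.Perm {a // ¬ p a}) =
              (1, Equiv.swap b.1 b.2) * (swapProd (a :: L₁), swapProd L₂) := by simp [swapProd]
          rw [e, map_mul, ← hr, ← ih]
          simp [glueList, swapProd, h]
  exact key L₁ L₂

lemma filter_glueList_left (L₁ : List ({a // p a} × {a // p a}))
    (L₂ : List ({a // ¬ p a} × {a // ¬ p a})) :
    (glueList p κ L₁ L₂).filter (fun q => decide (p q.2)) =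
      L₁.map (Prod.map Subtype.val Subtype.val) := by
  apply filter_merge_left
  · simp only [List.mem_map]; rintro _ ⟨q, _, rfl⟩; simpa using q.2.2
  · simp only [List.mem_map]; rintro _ ⟨q, _, rfl⟩; simpa using q.2.2

lemma filter_glueList_right (L₁ : List ({a // p a} × {a // p a}))
    (L₂ : List ({a // ¬ p a} × {a // ¬ p a})) :
    (glueList p κ L₁ L₂).filter (fun q => !decide (p q.2)) =
      L₂.map (Prod.map Subtype.val Subtype.val) := by
  apply filter_merge_right
  · simp only [List.mem_map]; rintro _ ⟨q, _, rfl⟩; simpa using q.2.2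
  · simp only [List.mem_map]; rintro _ ⟨q, _, rfl⟩; simpa using q.2.2

lemma exists_map_val {P : α → Prop} (L : List (α × α)) (h : ∀ q ∈ L, P q.1 ∧ P q.2) :
    ∃ L' : List ({a // P a} × {a // P a}), L'.map (Prod.map Subtype.val Subtype.val) = L := by
  induction L with
  | nil => exact ⟨[], rfl⟩
  | cons q L ih =>
    obtain ⟨L', hL'⟩ := ih fun r hr => h r (by simp [hr])
    have hq := h q (by simp)
    exact ⟨(⟨q.1, hq.1⟩, ⟨q.2, hq.2⟩) :: L', by simp [hL']⟩

lemma exists_glueList (hκ : Function.Injective κ) (L : List (α × α)) (hL : IsWord κ L)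
    (hp : ∀ q ∈ L, p q.1 ↔ p q.2) :
    ∃ (L₁ : List ({a // p a} × {a // p a})) (L₂ : List ({a // ¬ p a} × {a // ¬ p a})),
      IsWord (fun a : {a // p a} => κ a) L₁ ∧ IsWord (fun a : {a // ¬ p a} => κ a) L₂ ∧
      glueList p κ L₁ L₂ = L := by
  obtain ⟨L₁, h₁⟩ := exists_map_val (P := p) (L.filter fun q => decide (p q.2)) (by
    intro q hq
    simp only [List.mem_filter, decide_eq_true_eq] at hq
    exact ⟨(hp q hq.1).2 hq.2, hq.2⟩)
  obtain ⟨L₂, h₂⟩ := exists_map_val (P := fun a => ¬ p a) (L.filter fun q => !decide (p q.2)) (by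
    intro q hq
    simp only [List.mem_filter, Bool.not_eq_true', decide_eq_false_iff_not] at hq
    exact ⟨fun h => hq.2 ((hp q hq.1).1 h), hq.2⟩)
  refine ⟨L₁, L₂, ⟨?_, ?_⟩, ⟨?_, ?_⟩, ?_⟩
  · intro q hq
    have : Prod.map Subtype.val Subtype.val q ∈ L := by
      refine List.mem_of_mem_filter (p := fun q => decide (p q.2)) ?_
      rw [← h₁]; exact List.mem_map_of_mem hq
    exact hL.1 _ this
  · have := hL.2.filter fun q => decide (p q.2)
    rw [← h₁, List.pairwise_map] at this
    exact this
  · intro q hq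
    have : Prod.map Subtype.val Subtype.val q ∈ L := by
      refine List.mem_of_mem_filter (p := fun q => !decide (p q.2)) ?_
      rw [← h₂]; exact List.mem_map_of_mem hq
    exact hL.1 _ this
  · have := hL.2.filter fun q => !decide (p q.2)
    rw [← h₂, List.pairwise_map] at this
    exact this
  · rw [glueList, h₁, h₂]
    refine merge_filter (fun q : α × α => κ q.2) _ L hL.2 ?_
    intro a b ha hb hab
    rw [hκ hab] at ha
    simp_all

end GlueWords

section Glue

variable {α : Type} (p : α → Prop) (κ : α → ℕ) [DecidablePred p]

lemma Preserves.of_glue {σ : Equiv.Perm {a // p a}} {τ : Equiv.Perm {a // ¬ p a}}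
    {L₁ : List ({a // p a} × {a // p a})} {L₂ : List ({a // ¬ p a} × {a // ¬ p a})} {S : Set α}
    (h : Preserves (σ.subtypeCongr τ) (glueList p κ L₁ L₂) S) :
    Preserves σ L₁ (Subtype.val ⁻¹' S) := by
  constructor
  · intro a
    have := h.1 a
    rwa [Equiv.Perm.subtypeCongr.left_apply _ _ a.2] at this
  · intro q hq
    exact h.2 (↑q.1, ↑q.2) ((mem_glueList p κ L₁ L₂ _).2 (Or.inl ⟨q, hq, rfl⟩))

lemma Preserves.glue_image {σ : Equiv.Perm {a // p a}} {L₁ : List ({a // p a} × {a // p a})}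
    {T : Set {a // p a}} (h : Preserves σ L₁ T) (τ : Equiv.Perm {a // ¬ p a})
    (L₂ : List ({a // ¬ p a} × {a // ¬ p a})) :
    Preserves (σ.subtypeCongr τ) (glueList p κ L₁ L₂) (Subtype.val '' T) := by
  constructor
  · intro a
    by_cases ha : p a
    · have := h.1 ⟨a, ha⟩
      rw [Equiv.Perm.subtypeCongr.left_apply _ _ ha]
      rw [Subtype.val_injective.mem_set_image, this, ← Subtype.val_injective.mem_set_image]
    · rw [Equiv.Perm.subtypeCongr.right_apply _ _ ha]
      have h1 := (τ ⟨a, ha⟩).2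
      constructor
      · rintro ⟨b, _, hb⟩; exact absurd (hb ▸ b.2) h1
      · rintro ⟨b, _, hb⟩; exact absurd (hb ▸ b.2) ha
  · intro q hq
    rcases (mem_glueList p κ L₁ L₂ q).1 hq with ⟨r, hr, rfl⟩ | ⟨r, hr, rfl⟩
    · rw [Subtype.val_injective.mem_set_image, Subtype.val_injective.mem_set_image]
      exact h.2 r hr
    · refine iff_of_false ?_ ?_
      · rintro ⟨b, _, hb⟩; exact r.1.2 (hb.subst (motive := p) b.2)
      · rintro ⟨b, _, hb⟩; exact r.2.2 (hb.subst (motive := p) b.2)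

lemma exists_glue_perm (σ : Equiv.Perm α) (h : ∀ a, p (σ a) ↔ p a) :
    ∃ (σ₁ : Equiv.Perm {a // p a}) (σ₂ : Equiv.Perm {a // ¬ p a}), σ₁.subtypeCongr σ₂ = σ := by
  refine ⟨σ.subtypePerm h, σ.subtypePerm fun a => not_congr (h a), ?_⟩
  ext a
  by_cases ha : p a
  · rw [Equiv.Perm.subtypeCongr.left_apply _ _ ha]; rfl
  · rw [Equiv.Perm.subtypeCongr.right_apply _ _ ha]; rfl

end Glue

lemma Preserves.sInter {α : Type} {σ : Equiv.Perm α} {L : List (α × α)} (C : Set (Set α))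
    (h : ∀ S ∈ C, Preserves σ L S) : Preserves σ L (⋂₀ C) := by
  constructor
  · intro a
    simp only [Set.mem_sInter]
    exact forall₂_congr fun S hS => (h S hS).1 a
  · intro q hq
    simp only [Set.mem_sInter]
    exact forall₂_congr fun S hS => (h S hS).2 q hq

lemma Preserves.diff {α : Type} {σ : Equiv.Perm α} {L : List (α × α)} {S T : Set α}
    (hS : Preserves σ L S) (hT : Preserves σ L T) : Preserves σ L (S \ T) :=
  ⟨fun a => and_congr (hS.1 a) (not_congr (hT.1 a)),
    fun q hq => and_congr (hS.2 q hq) (not_congr (hT.2 q hq))⟩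

/-- The weight of a pair consisting of a permutation and a monotone word. -/
noncomputable def wordWeight {α n : Type} [Fintype α] [DecidableEq α] [Fintype n] (x : ℂ)
    (A B : Matrix n n ℂ) (κ : α → ℕ) (q : Equiv.Perm α × Word κ) : ℂ :=
  x ^ q.2.1.length * permSum (fun _ => A) (q.1 * swapProd q.2.1)⁻¹ * permSum (fun _ => B) q.1

/-- The total weight of all pairs of a permutation and a monotone word. -/
noncomputable def fullSeries {α n : Type} [Fintype α] [DecidableEq α] [Fintype n] (x : ℂ)
    (A B : Matrix n n ℂ) (κ : α → ℕ) : ℂ :=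
  ∑' q : Equiv.Perm α × Word κ, wordWeight x A B κ q

/-- The total weight of the transitive pairs of a permutation and a monotone word. -/
noncomputable def connSeries {α n : Type} [Fintype α] [DecidableEq α] [Fintype n] (x : ℂ)
    (A B : Matrix n n ℂ) (κ : α → ℕ) : ℂ :=
  ∑' q : {q : Equiv.Perm α × Word κ // IsConn q.1 q.2.1}, wordWeight x A B κ q

lemma summable_length_pow {α : Type} [Fintype α] [DecidableEq α] (κ : α → ℕ) (y : ℝ) (h0 : 0 ≤ y)
    (hy : (Fintype.card α : ℝ) ^ 2 * y < 1) :
    Summable fun q : Equiv.Perm α × Word κ => y ^ q.2.1.length := by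
  have h1 : Summable fun L : List (α × α) => y ^ L.length :=
    summable_list_pow y h0 (by rw [Fintype.card_prod]; push_cast; nlinarith)
  have h2 : Summable fun L : Word κ => y ^ L.1.length := h1.subtype _
  have h3 : Summable fun _ : Equiv.Perm α => (1 : ℝ) := Summable.of_finite
  simpa using h3.mul_of_nonneg h2 (fun _ => zero_le_one) (fun _ => by positivity)

lemma summable_wordWeight {α n : Type} [Fintype α] [DecidableEq α] [Fintype n] (x : ℂ)
    (A B : Matrix n n ℂ) (κ : α → ℕ) (hx : (Fintype.card α : ℝ) ^ 2 * ‖x‖ < 1) :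
    Summable fun q => ‖wordWeight x A B κ q‖ := by
  obtain ⟨K, hK⟩ := (Set.finite_range fun q : Equiv.Perm α × Equiv.Perm α =>
    ‖permSum (fun _ => A) q.1‖ * ‖permSum (fun _ => B) q.2‖).bddAbove
  refine Summable.of_nonneg_of_le (fun _ => norm_nonneg _) (fun q => ?_)
    ((summable_length_pow κ ‖x‖ (norm_nonneg _) hx).mul_right K)
  rw [wordWeight, mul_assoc, norm_mul, norm_mul, norm_pow]
  exact mul_le_mul_of_nonneg_left (hK ⟨((q.1 * swapProd q.2.1)⁻¹, q.1), rfl⟩) (by positivity)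

section Recursion

variable {α : Type} [Fintype α] [DecidableEq α] (κ : α → ℕ)

/-- Combine a permutation and a word on `p` with a permutation and a word on its complement. -/
def gluePair (p : α → Prop) [DecidablePred p]
    (q : (Equiv.Perm {a // p a} × Word fun a : {a // p a} => κ a) ×
      (Equiv.Perm {a // ¬ p a} × Word fun a : {a // ¬ p a} => κ a)) : Equiv.Perm α × Word κ :=
  (q.1.1.subtypeCongr q.2.1, ⟨glueList p κ q.1.2.1 q.2.2.1, isWord_glueList p κ q.1.2.2 q.2.2.2⟩)

omit [Fintype α] [DecidableEq α] in
lemma gluePair_injective (p : α → Prop) [DecidablePred p] :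
    Function.Injective (gluePair κ p) := by
  rintro ⟨⟨σ₁, L₁⟩, τ₁, M₁⟩ ⟨⟨σ₂, L₂⟩, τ₂, M₂⟩ h
  rw [gluePair, gluePair, Prod.mk.injEq, Subtype.mk.injEq] at h
  have h1 : (σ₁, τ₁) = (σ₂, τ₂) := Equiv.Perm.subtypeCongrHom_injective p h.1
  have h2 := congrArg (List.filter fun q => decide (p q.2)) h.2
  have h3 := congrArg (List.filter fun q => !decide (p q.2)) h.2
  simp only [filter_glueList_left] at h2
  simp only [filter_glueList_right] at h3
  have h4 : L₁ = L₂ := Subtype.ext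
    (List.map_injective_iff.2 (Subtype.val_injective.prodMap Subtype.val_injective) h2)
  have h5 : M₁ = M₂ := Subtype.ext
    (List.map_injective_iff.2 (Subtype.val_injective.prodMap Subtype.val_injective) h3)
  rw [Prod.mk.injEq] at h1
  rw [h1.1, h1.2, h4, h5]

lemma wordWeight_gluePair {n : Type} [Fintype n] (x : ℂ) (A B : Matrix n n ℂ) (p : α → Prop)
    [DecidablePred p] [Fintype {a // p a}] [Fintype {a // ¬ p a}] (q) : wordWeight x A B κ (gluePair κ p q) =
      wordWeight x A B (fun a : {a // p a} => κ a) q.1 *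
        wordWeight x A B (fun a : {a // ¬ p a} => κ a) q.2 := by
  have h : (q.1.1.subtypeCongr q.2.1 * (swapProd q.1.2.1).subtypeCongr (swapProd q.2.2.1))⁻¹ =
      ((q.1.1 * swapProd q.1.2.1)⁻¹).subtypeCongr (q.2.1 * swapProd q.2.2.1)⁻¹ := by
    have := map_inv (Equiv.Perm.subtypeCongrHom p)
      ((q.1.1, q.2.1) * (swapProd q.1.2.1, swapProd q.2.2.1))
    rw [map_mul] at this
    exact this.symm
  simp only [wordWeight, gluePair]
  rw [length_glueList, swapProd_glueList, h, permSum_subtypeCongr, permSum_subtypeCongr, pow_add]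
  ring

/-- Combine a transitive pair on a set containing `x₀` with a pair on the complement. -/
def glueSigma (x₀ : α) (q : Σ S : {S : Finset α // x₀ ∈ S},
    {r : Equiv.Perm {a // a ∈ S.1} × Word (fun a : {a // a ∈ S.1} => κ a) //
      IsConn r.1 r.2.1} ×
    (Equiv.Perm {a // ¬ a ∈ S.1} × Word fun a : {a // ¬ a ∈ S.1} => κ a)) :
    Equiv.Perm α × Word κ :=
  gluePair κ (fun a => a ∈ q.1.1) (q.2.1.1, q.2.2)

omit [Fintype α] in
lemma subset_of_isConn {S : Finset α} {σ : Equiv.Perm {a // a ∈ S}}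
    {τ : Equiv.Perm {a // ¬ a ∈ S}}
    {L₁ : List ({a // a ∈ S} × {a // a ∈ S})} {L₂ : List ({a // ¬ a ∈ S} × {a // ¬ a ∈ S})}
    (h : IsConn σ L₁) {T : Set α} (hT : Preserves (σ.subtypeCongr τ) (glueList _ κ L₁ L₂) T)
    {x : α} (hx : x ∈ S) (hxT : x ∈ T) : (S : Set α) ⊆ T := by
  have := h _ (hT.of_glue (fun a => a ∈ S) κ) ⟨⟨x, hx⟩, hxT⟩
  intro a ha
  have ha' : (⟨a, ha⟩ : {a // a ∈ S}) ∈ (Subtype.val ⁻¹' T : Set {a // a ∈ S}) := by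
    rw [this]; trivial
  exact ha'

omit [Fintype α] in
lemma preserves_glue_self {S : Finset α} (σ : Equiv.Perm {a // a ∈ S})
    (τ : Equiv.Perm {a // ¬ a ∈ S})
    (L₁ : List ({a // a ∈ S} × {a // a ∈ S})) (L₂ : List ({a // ¬ a ∈ S} × {a // ¬ a ∈ S})) :
    Preserves (σ.subtypeCongr τ) (glueList _ κ L₁ L₂) (S : Set α) := by
  have h : Preserves σ L₁ Set.univ := ⟨fun _ => by simp, fun _ _ => by simp⟩
  have := h.glue_image (fun a => a ∈ S) κ τ L₂
  rw [Set.image_univ, Subtype.range_coe_subtype] at this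
  exact this

omit [Fintype α] in
lemma glueSigma_injective (x₀ : α) : Function.Injective (glueSigma κ x₀) := by
  rintro ⟨⟨S, hS⟩, ⟨r, hr⟩, s⟩ ⟨⟨S', hS'⟩, ⟨r', hr'⟩, s'⟩ h
  have e1 : (gluePair κ (fun a => a ∈ S) (r, s)).1 =
    (gluePair κ (fun a => a ∈ S') (r', s')).1 := congrArg Prod.fst h
  have e2 : (gluePair κ (fun a => a ∈ S) (r, s)).2.1 =
    (gluePair κ (fun a => a ∈ S') (r', s')).2.1 := congrArg (fun q => q.2.1) h
  have hSS' : S = S' := by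
    refine Finset.coe_injective (Set.Subset.antisymm ?_ ?_)
    · refine subset_of_isConn (τ := s.1) (L₂ := s.2.1) κ hr ?_ hS hS'
      have := preserves_glue_self κ r'.1 s'.1 r'.2.1 s'.2.1
      simp only [gluePair] at e1 e2
      rwa [← e1, ← e2] at this
    · refine subset_of_isConn (τ := s'.1) (L₂ := s'.2.1) κ hr' ?_ hS' hS
      have := preserves_glue_self κ r.1 s.1 r.2.1 s.2.1
      simp only [gluePair] at e1 e2
      rwa [e1, e2] at this
  subst hSS'
  have := gluePair_injective κ _ h
  simp only [Prod.mk.injEq] at this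
  obtain ⟨rfl, rfl⟩ := this
  rfl

lemma glueSigma_surjective (hκ : Function.Injective κ) (x₀ : α) :
    Function.Surjective (glueSigma κ x₀) := by
  classical
  rintro ⟨σ, L, hL⟩
  let T : Set α := ⋂₀ {S | Preserves σ L S ∧ x₀ ∈ S}
  have hT : Preserves σ L T := Preserves.sInter _ fun S hS => hS.1
  have hx : x₀ ∈ T := fun S hS => hS.2
  have hmin : ∀ S, Preserves σ L S → x₀ ∈ S → T ⊆ S := fun S h1 h2 =>
    Set.sInter_subset_of_mem ⟨h1, h2⟩
  let S : Finset α := T.toFinset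
  have hmem : ∀ a, a ∈ S ↔ a ∈ T := fun a => Set.mem_toFinset
  obtain ⟨σ₁, σ₂, hσ⟩ := exists_glue_perm (fun a => a ∈ S) σ fun a => by
    rw [hmem, hmem]; exact hT.1 a
  obtain ⟨L₁, L₂, h₁, h₂, hL'⟩ := exists_glueList (fun a => a ∈ S) κ hκ L hL fun q hq => by
    rw [hmem, hmem]; exact hT.2 q hq
  have hconn : IsConn σ₁ L₁ := by
    intro U hU hne
    have hU' := hU.glue_image (fun a => a ∈ S) κ σ₂ L₂
    rw [hσ, hL'] at hU'
    have hUT : Subtype.val '' U ⊆ T := by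
      rintro _ ⟨b, _, rfl⟩; exact (hmem b).1 b.2
    by_cases h0 : x₀ ∈ Subtype.val '' U
    · refine Set.eq_univ_of_forall fun b => ?_
      obtain ⟨c, hc, hcb⟩ := hmin _ hU' h0 ((hmem b).1 b.2)
      rwa [← Subtype.ext hcb]
    · obtain ⟨b, hb⟩ := hne
      have := hmin _ (hT.diff hU') ⟨hx, h0⟩ ((hmem b).1 b.2)
      exact absurd ⟨b, hb, rfl⟩ this.2
  refine ⟨⟨⟨S, (hmem x₀).2 hx⟩, ⟨(σ₁, ⟨L₁, h₁⟩), hconn⟩, (σ₂, ⟨L₂, h₂⟩)⟩, ?_⟩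
  simp only [glueSigma, gluePair, hσ, hL']

lemma connSeries_mul_fullSeries {n : Type} [Fintype n] (x : ℂ) (A B : Matrix n n ℂ)
    (hx : (Fintype.card α : ℝ) ^ 2 * ‖x‖ < 1) (S : Finset α) :
    connSeries x A B (fun a : {a // a ∈ S} => κ a) *
        fullSeries x A B (fun a : {a // ¬ a ∈ S} => κ a) =
      ∑' q : {r : Equiv.Perm {a // a ∈ S} × Word (fun a : {a // a ∈ S} => κ a) //
          IsConn r.1 r.2.1} ×
        (Equiv.Perm {a // ¬ a ∈ S} × Word fun a : {a // ¬ a ∈ S} => κ a),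
        wordWeight x A B κ (gluePair κ (fun a => a ∈ S) (q.1.1, q.2)) := by
  have hcard : ∀ (P : α → Prop) [Fintype {a // P a}],
      (Fintype.card {a // P a} : ℝ) ^ 2 * ‖x‖ < 1 := by
    intro P _
    refine lt_of_le_of_lt (mul_le_mul_of_nonneg_right ?_ (norm_nonneg _)) hx
    have : Fintype.card {a // P a} ≤ Fintype.card α :=
      Fintype.card_le_of_injective _ Subtype.val_injective
    gcongr
  rw [connSeries, fullSeries, tsum_mul_tsum_of_summable_norm]
  · refine tsum_congr fun q => ?_
    rw [wordWeight_gluePair]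
  · exact (summable_wordWeight x A B _ (hcard _)).subtype _
  · exact summable_wordWeight x A B _ (hcard _)

lemma tsum_eq_sum_tsum_of_bijective {ι β : Type} {γ : ι → Type} [Fintype ι]
    (g : (Σ i, γ i) → β) (hg : Function.Bijective g) (f : β → ℂ) (hf : Summable f) :
    ∑' b, f b = ∑ i, ∑' c : γ i, f (g ⟨i, c⟩) := by
  have h : Summable fun c => f (Equiv.ofBijective g hg c) :=
    (Equiv.ofBijective g hg).summable_iff.2 hf
  rw [← (Equiv.ofBijective g hg).tsum_eq, h.tsum_sigma, tsum_fintype]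
  rfl

lemma fullSeries_eq_sum {n : Type} [Fintype n] (x : ℂ) (A B : Matrix n n ℂ)
    (hκ : Function.Injective κ) (hx : (Fintype.card α : ℝ) ^ 2 * ‖x‖ < 1) (x₀ : α) :
    fullSeries x A B κ = ∑ S : {S : Finset α // x₀ ∈ S},
      connSeries x A B (fun a : {a // a ∈ S.1} => κ a) *
        fullSeries x A B (fun a : {a // ¬ a ∈ S.1} => κ a) := by
  rw [fullSeries, tsum_eq_sum_tsum_of_bijective (glueSigma κ x₀)
    ⟨glueSigma_injective κ x₀, glueSigma_surjective κ hκ x₀⟩ _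
    (summable_wordWeight x A B κ hx).of_norm]
  refine Finset.sum_congr rfl fun S _ => ?_
  rw [connSeries_mul_fullSeries κ x A B hx S.1]
  rfl

end Recursion

section Transport

variable {α β : Type} {κ : α → ℕ} {κ' : β → ℕ}

lemma IsWord.map {e : α ≃ β} (he : ∀ a b, κ a < κ b ↔ κ' (e a) < κ' (e b))
    {L : List (α × α)} : IsWord κ' (L.map (e.prodCongr e)) ↔ IsWord κ L := by
  have h : (fun a b : α × α => κ' (e a.2) ≤ κ' (e b.2)) = fun a b => κ a.2 ≤ κ b.2 := by
    ext a b
    rw [← not_lt, ← not_lt, he]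
  unfold IsWord
  rw [List.pairwise_map, List.forall_mem_map, ← h]
  exact and_congr_left' (forall₂_congr fun q _ => (he _ _).symm)

/-- Monotone words on equivalent ordered alphabets correspond to each other. -/
def wordEquiv (e : α ≃ β) (he : ∀ a b, κ a < κ b ↔ κ' (e a) < κ' (e b)) : Word κ ≃ Word κ' :=
  (Equiv.listEquivOfEquiv (e.prodCongr e)).subtypeEquiv fun _ => (IsWord.map he).symm

lemma swapProd_map [DecidableEq α] [DecidableEq β] (e : α ≃ β) (L : List (α × α)) :
    swapProd (L.map (e.prodCongr e)) = e.permCongr (swapProd L) := by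
  induction L with
  | nil => ext; simp [swapProd]
  | cons q L ih =>
    simp only [swapProd, List.map_cons, List.prod_cons] at ih ⊢
    rw [ih]
    ext b
    simp [Equiv.swap_apply_def, Equiv.permCongr_apply]
    split_ifs <;> simp_all

lemma isConn_map (e : α ≃ β) (σ : Equiv.Perm α) (L : List (α × α)) :
    IsConn (e.permCongr σ) (L.map (e.prodCongr e)) ↔ IsConn σ L := by
  have key : ∀ S : Set β, Preserves (e.permCongr σ) (L.map (e.prodCongr e)) S ↔
      Preserves σ L (e ⁻¹' S) := fun S => by
    unfold Preserves
    rw [List.forall_mem_map]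
    refine and_congr ?_ Iff.rfl
    rw [← e.forall_congr_right]
    simp
  constructor
  · intro h S hS hne
    have h1 : e ⁻¹' (e.symm ⁻¹' S) = S := by ext; simp
    have := h (e.symm ⁻¹' S) ((key _).2 (by rwa [h1]))
      (hne.preimage e.symm.surjective)
    rw [← h1, this, Set.preimage_univ]
  · intro h S hS hne
    have := h _ ((key S).1 hS) (hne.preimage e.surjective)
    exact Set.preimage_injective.2 e.surjective (by rw [this, Set.preimage_univ])

variable [Fintype α] [DecidableEq α] [Fintype β] [DecidableEq β] {n : Type} [Fintype n]

lemma wordWeight_map (x : ℂ) (A B : Matrix n n ℂ) (e : α ≃ β)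
    (he : ∀ a b, κ a < κ b ↔ κ' (e a) < κ' (e b)) (q : Equiv.Perm α × Word κ) :
    wordWeight x A B κ' (e.permCongr q.1, wordEquiv e he q.2) = wordWeight x A B κ q := by
  have h1 : ((wordEquiv e he q.2).1 : List (β × β)) = q.2.1.map (e.prodCongr e) := rfl
  have h2 : (e.permCongr q.1 * e.permCongr (swapProd q.2.1))⁻¹ =
      e.permCongr (q.1 * swapProd q.2.1)⁻¹ := by
    have := map_inv (Equiv.permCongrHom e) (q.1 * swapProd q.2.1)
    rw [map_mul] at this
    exact this.symm
  simp only [wordWeight, h1, swapProd_map, List.length_map, h2, permSum_reindex]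
  rfl

lemma fullSeries_map (x : ℂ) (A B : Matrix n n ℂ) (e : α ≃ β)
    (he : ∀ a b, κ a < κ b ↔ κ' (e a) < κ' (e b)) :
    fullSeries x A B κ' = fullSeries x A B κ := by
  rw [fullSeries, fullSeries, ← (e.permCongr.prodCongr (wordEquiv e he)).tsum_eq]
  exact tsum_congr fun q => wordWeight_map x A B e he q

lemma connSeries_map (x : ℂ) (A B : Matrix n n ℂ) (e : α ≃ β)
    (he : ∀ a b, κ a < κ b ↔ κ' (e a) < κ' (e b)) :
    connSeries x A B κ' = connSeries x A B κ := by
  rw [connSeries, connSeries, ← ((e.permCongr.prodCongr (wordEquiv e he)).subtypeEquiv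
    (p := fun q : Equiv.Perm α × Word κ => IsConn q.1 q.2.1)
    (q := fun q : Equiv.Perm β × Word κ' => IsConn q.1 q.2.1)
    fun q => (isConn_map e q.1 q.2.1).symm).tsum_eq]
  exact tsum_congr fun q => wordWeight_map x A B e he q.1

omit [DecidableEq α] in
lemma exists_equiv_fin (hκ : Function.Injective κ) {m : ℕ} (hm : Fintype.card α = m) :
    ∃ e : α ≃ Fin m, ∀ a b, κ a < κ b ↔ (e a : ℕ) < e b := by
  let _ : LinearOrder α := LinearOrder.lift' κ hκ
  let e := (Fintype.orderIsoFinOfCardEq α hm).symm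
  exact ⟨e.toEquiv, fun a b => (e.lt_iff_lt (x := a) (y := b)).symm⟩

end Transport

lemma fullSeries_succ {n : Type} [Fintype n] (x : ℂ) (A B : Matrix n n ℂ) (m : ℕ)
    (hx : ((m + 1 : ℕ) : ℝ) ^ 2 * ‖x‖ < 1) :
    fullSeries x A B (Fin.val : Fin (m + 1) → ℕ) = ∑ k ∈ Finset.range (m + 1),
      (m.choose k : ℂ) * connSeries x A B (Fin.val : Fin (k + 1) → ℕ) *
        fullSeries x A B (Fin.val : Fin (m - k) → ℕ) := by
  rw [fullSeries_eq_sum Fin.val x A B Fin.val_injective (by simpa using hx) 0]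
  let g : ℕ → ℂ := fun k => fullSeries x A B (Fin.val : Fin k → ℕ)
  let f : ℕ → ℂ := fun k => connSeries x A B (Fin.val : Fin k → ℕ) * g (m + 1 - k)
  have h1 : ∀ S : Finset (Fin (m + 1)), connSeries x A B (fun a : {a // a ∈ S} => (a : ℕ)) *
        fullSeries x A B (fun a : {a // ¬ a ∈ S} => (a : ℕ)) = f S.card := by
    intro S
    obtain ⟨e₁, h₁⟩ := exists_equiv_fin (κ := fun a : {a // a ∈ S} => (a : ℕ)) (m := S.card)
      (Fin.val_injective.comp Subtype.val_injective) (by simp)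
    obtain ⟨e₂, h₂⟩ := exists_equiv_fin (κ := fun a : {a // ¬ a ∈ S} => (a : ℕ))
      (m := m + 1 - S.card)
      (Fin.val_injective.comp Subtype.val_injective) (by
        rw [Fintype.card_subtype_compl]; simp)
    rw [← connSeries_map x A B e₁ h₁, ← fullSeries_map x A B e₂ h₂]
  simp only [h1]
  have h2 : ∑ S : {S : Finset (Fin (m + 1)) // 0 ∈ S}, f S.1.card =
      ∑ S ∈ Finset.univ.filter fun S : Finset (Fin (m + 1)) => 0 ∈ S, f S.card := by
    exact (Finset.sum_subtype _ (by simp) fun S : Finset (Fin (m + 1)) => f S.card).symm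
  have h3 : ∑ S ∈ Finset.univ.filter (fun S : Finset (Fin (m + 1)) => 0 ∈ S), f S.card =
      ∑ T ∈ (Finset.univ.erase (0 : Fin (m + 1))).powerset, f (T.card + 1) := by
    refine Finset.sum_bij' (fun S _ => S.erase 0) (fun T _ => insert 0 T) ?_ ?_ ?_ ?_ ?_
    · intro S _
      exact Finset.mem_powerset.2 (Finset.erase_subset_erase _ (Finset.subset_univ _))
    · intro T _
      simp
    · intro S hS
      exact Finset.insert_erase (Finset.mem_filter.1 hS).2
    · intro T hT
      exact Finset.erase_insert fun h0 => by simpa using Finset.mem_powerset.1 hT h0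
    · intro S hS
      rw [Finset.card_erase_add_one (Finset.mem_filter.1 hS).2]
  rw [h2, h3, Finset.sum_powerset_apply_card fun k => f (k + 1)]
  simp only [Finset.card_erase_of_mem (Finset.mem_univ _), Finset.card_univ, Fintype.card_fin,
    Nat.add_sub_cancel, nsmul_eq_mul, mul_assoc]
  refine Finset.sum_congr rfl fun k _ => ?_
  have h4 : f (k + 1) = connSeries x A B (Fin.val : Fin (k + 1) → ℕ) * g (m - k) := by
    simp only [f, Nat.add_sub_add_right]
  rw [h4]

section DecomposeFin

variable {m : Type} [Fintype m] {n : ℕ}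

lemma permSum_decomposeFin_zero (M : Fin (n + 1) → Matrix m m ℂ) (e : Equiv.Perm (Fin n)) :
    permSum M (Equiv.Perm.decomposeFin.symm (0, e)) =
      (M 0).trace * permSum (fun k => M k.succ) e := by
  unfold permSum Matrix.trace
  rw [← (Fin.consEquiv fun _ : Fin (n + 1) => m).sum_comp, Finset.sum_mul_sum,
    ← Finset.univ_product_univ, Finset.sum_product]
  refine Finset.sum_congr rfl fun a _ => Finset.sum_congr rfl fun f _ => ?_
  rw [Fin.prod_univ_succ]
  simp [Fin.consEquiv]

lemma permSum_decomposeFin_succ (M : Fin (n + 1) → Matrix m m ℂ) (a : Fin n)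
    (e : Equiv.Perm (Fin n)) :
    permSum M (Equiv.Perm.decomposeFin.symm (a.succ, e)) =
      permSum (Function.update (fun k => M k.succ) a (M 0 * M a.succ)) e := by
  unfold permSum
  rw [← ((Equiv.swap (0 : Fin (n + 1)) a.succ).arrowCongr (Equiv.refl m)).sum_comp,
    ← (Fin.consEquiv fun _ : Fin (n + 1) => m).sum_comp,
    ← Finset.univ_product_univ, Finset.sum_product_right]
  refine Finset.sum_congr rfl fun f _ => ?_
  rw [← Finset.mul_prod_erase _ _ (Finset.mem_univ a), Function.update_self, Matrix.mul_apply,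
    Finset.sum_mul]
  refine Finset.sum_congr rfl fun c _ => ?_
  rw [Fin.prod_univ_succ, ← Finset.mul_prod_erase _ _ (Finset.mem_univ a), ← mul_assoc]
  congr 1
  · simp [Fin.consEquiv]
  · refine Finset.prod_congr rfl fun k hk => ?_
    have hk : k ≠ a := Finset.ne_of_mem_erase hk
    rw [Function.update_of_ne hk]
    have h0 : Equiv.swap (0 : Fin (n + 1)) a.succ k.succ = k.succ :=
      Equiv.swap_apply_of_ne_of_ne (Fin.succ_ne_zero k) fun h => hk (Fin.succ_injective _ h)
    simp [Fin.consEquiv, h0]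

end DecomposeFin

/-- The key on `Fin n` that reverses the order. -/
def revKey {n : ℕ} (l : Fin n) : ℕ := n - l

lemma revKey_lt {n : ℕ} {k l : Fin n} : revKey k < revKey l ↔ l < k := by
  unfold revKey
  rw [Fin.lt_def]
  omega

lemma revKey_le {n : ℕ} {k l : Fin n} : revKey k ≤ revKey l ↔ l ≤ k := by
  rw [← not_lt, revKey_lt, not_lt]

/-- Extend a list of pairs from `Fin n` to `Fin (n + 1)`. -/
def succList {n : ℕ} (L : List (Fin n × Fin n)) : List (Fin (n + 1) × Fin (n + 1)) :=
  L.map (Prod.map Fin.succ Fin.succ)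

lemma isWord_succList {n : ℕ} {L : List (Fin n × Fin n)} :
    IsWord revKey (succList L) ↔ IsWord revKey L := by
  unfold IsWord succList
  rw [List.pairwise_map, List.forall_mem_map]
  simp [revKey_lt, revKey_le]

lemma swapProd_succList {n : ℕ} (L : List (Fin n × Fin n)) :
    swapProd (succList L) = Equiv.Perm.decomposeFin.symm (0, swapProd L) := by
  induction L with
  | nil =>
    rw [show succList ([] : List (Fin n × Fin n)) = [] from rfl]
    simp [swapProd, Equiv.Perm.one_def]
  | cons q L ih =>
    simp only [swapProd, succList, List.map_cons, List.prod_cons] at ih ⊢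
    rw [ih]
    ext l
    refine Fin.cases ?_ (fun k => ?_) l
    · simp [Equiv.swap_apply_of_ne_of_ne, Ne.symm (Fin.succ_ne_zero _)]
    · simp [← Fin.succ_injective _ |>.swap_apply]

lemma swapProd_append {α : Type} [DecidableEq α] (L : List (α × α)) (q : α × α) :
    swapProd (L ++ [q]) = swapProd L * Equiv.swap q.1 q.2 := by
  simp [swapProd]

lemma isWord_append {n : ℕ} (L : List (Fin (n + 1) × Fin (n + 1))) (k : Fin n) :
    IsWord revKey (L ++ [(k.succ, 0)]) ↔ IsWord revKey L := by
  unfold IsWord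
  rw [List.pairwise_append]
  simp [revKey_lt, revKey_le, or_imp, forall_and]

/-- Words on `Fin (n + 1)` are words on `Fin n`, or end in a transposition that moves `0`. -/
def wordCons {n : ℕ} :
    Word (revKey : Fin n → ℕ) ⊕ Fin n × Word (revKey : Fin (n + 1) → ℕ) →
      Word (revKey : Fin (n + 1) → ℕ)
  | Sum.inl L => ⟨succList L.1, isWord_succList.2 L.2⟩
  | Sum.inr q => ⟨q.2.1 ++ [(q.1.succ, 0)], (isWord_append _ _).2 q.2.2⟩

lemma wordCons_bijective {n : ℕ} : Function.Bijective (wordCons (n := n)) := by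
  have hne : ∀ (L : List (Fin n × Fin n)) (L' : List (Fin (n + 1) × Fin (n + 1))) k,
      succList L ≠ L' ++ [(k, 0)] := by
    intro L L' k h
    have : (k, (0 : Fin (n + 1))) ∈ succList L := by rw [h]; simp
    obtain ⟨q, _, hq⟩ := List.mem_map.1 this
    exact Fin.succ_ne_zero _ (congrArg Prod.snd hq)
  constructor
  · rintro (⟨L, hL⟩ | ⟨k, L, hL⟩) (⟨L', hL'⟩ | ⟨k', L', hL'⟩) h
    · have h' : succList L = succList L' := congrArg Subtype.val h
      have : L = L' := List.map_injective_iff.2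
        ((Fin.succ_injective n).prodMap (Fin.succ_injective n)) h'
      subst this; rfl
    · exact absurd (congrArg Subtype.val h) (hne _ _ _)
    · exact absurd (congrArg Subtype.val h).symm (hne _ _ _)
    · have h' : L ++ [(k.succ, 0)] = L' ++ [(k'.succ, 0)] := congrArg Subtype.val h
      rw [List.append_singleton_inj] at h'
      obtain ⟨rfl, h2⟩ := h'
      obtain rfl : k = k' := Fin.succ_injective _ (congrArg Prod.fst h2)
      rfl
  · rintro ⟨L, hL⟩
    by_cases h : ∃ q ∈ L, q.2 = 0
    · rcases List.eq_nil_or_concat' L with rfl | ⟨L', ⟨s, t⟩, rfl⟩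
      · simp at h
      · have ht : t = 0 := by
          obtain ⟨q, hq, hq0⟩ := h
          rcases List.mem_append.1 hq with hq | hq
          · have := (List.pairwise_append.1 hL.2).2.2 q hq (s, t) (by simp)
            rw [revKey_le, hq0] at this
            exact Fin.le_zero_iff.1 this
          · rw [List.mem_singleton] at hq
            rw [hq] at hq0
            exact hq0
        subst ht
        have hs := hL.1 (s, 0) (by simp)
        rw [revKey_lt] at hs
        obtain ⟨k, rfl⟩ := Fin.exists_succ_eq.2 hs.ne'
        exact ⟨Sum.inr (k, ⟨L', (isWord_append _ _).1 hL⟩), rfl⟩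
    · have : ∃ L' : List (Fin n × Fin n), succList L' = L := by
        rw [← Set.mem_range]
        unfold succList
        rw [Set.range_list_map]
        intro q hq
        have h2 : q.2 ≠ 0 := fun h0 => h ⟨q, hq, h0⟩
        have h1 := hL.1 q hq
        rw [revKey_lt] at h1
        obtain ⟨k, hk⟩ := Fin.exists_succ_eq.2 h2
        obtain ⟨l, hl⟩ := Fin.exists_succ_eq.2 (Fin.ne_zero_of_lt h1)
        exact ⟨(l, k), Prod.ext hl hk⟩
      obtain ⟨L', rfl⟩ := this
      exact ⟨Sum.inl ⟨L', isWord_succList.1 hL⟩, rfl⟩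

section WordSum

variable {m : Type} [Fintype m] [DecidableEq m] {n : ℕ}

/-- The sum of the traces of `B` along the permutations `σ` with `i ∘ σ ∘ π = j`. -/
noncomputable def matchSum (B : Fin n → Matrix m m ℂ) (i j : Fin n → m)
    (π : Equiv.Perm (Fin n)) : ℂ :=
  ∑ σ : Equiv.Perm (Fin n), if i ∘ (σ * π : Equiv.Perm (Fin n)) = j then permSum B σ else 0

/-- The weighted sum of `matchSum` over all monotone words. -/
noncomputable def wordSum (x : ℂ) (B : Fin n → Matrix m m ℂ) (i j : Fin n → m) : ℂ :=
  ∑' L : Word (revKey : Fin n → ℕ), x ^ L.1.length * matchSum B i j (swapProd L.1)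

lemma matchSum_mul_swap (B : Fin n → Matrix m m ℂ) (i j : Fin n → m)
    (π : Equiv.Perm (Fin n)) (a b : Fin n) :
    matchSum B i j (π * Equiv.swap a b) = matchSum B i (j ∘ Equiv.swap a b) π := by
  unfold matchSum
  refine Finset.sum_congr rfl fun σ _ => ?_
  refine if_congr ?_ rfl rfl
  have h : ∀ f : Fin n → m, (f ∘ Equiv.swap a b) ∘ Equiv.swap a b = f := fun f => by ext; simp
  rw [← mul_assoc, Equiv.Perm.coe_mul, ← Function.comp_assoc]
  exact ⟨fun hf => by rw [← hf, h], fun hf => by rw [hf, h]⟩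

omit [Fintype m] [DecidableEq m] in
lemma comp_decomposeFin_zero (i j : Fin (n + 1) → m) (e π : Equiv.Perm (Fin n)) :
    i ∘ (Equiv.Perm.decomposeFin.symm (0, e) * Equiv.Perm.decomposeFin.symm (0, π) :
      Equiv.Perm (Fin (n + 1))) = j ↔
      i 0 = j 0 ∧ (fun k => i k.succ) ∘ (e * π : Equiv.Perm (Fin n)) = fun k => j k.succ := by
  simp only [funext_iff]
  rw [Fin.forall_fin_succ]
  simp

omit [Fintype m] [DecidableEq m] in
lemma comp_decomposeFin_succ (i j : Fin (n + 1) → m) (a : Fin n) (e π : Equiv.Perm (Fin n)) :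
    i ∘ (Equiv.Perm.decomposeFin.symm (a.succ, e) * Equiv.Perm.decomposeFin.symm (0, π) :
      Equiv.Perm (Fin (n + 1))) = j ↔
      i a.succ = j 0 ∧ Function.update (fun k => i k.succ) a (i 0) ∘
        (e * π : Equiv.Perm (Fin n)) = fun k => j k.succ := by
  simp only [funext_iff]
  rw [Fin.forall_fin_succ]
  refine and_congr (by simp) (forall_congr' fun k => ?_)
  have : i (Equiv.swap 0 a.succ (e (π k)).succ) =
      Function.update (fun k => i k.succ) a (i 0) (e (π k)) := by
    rcases eq_or_ne (e (π k)) a with h | h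
    · simp [h]
    · rw [Function.update_of_ne h, Equiv.swap_apply_of_ne_of_ne (Fin.succ_ne_zero _)
        fun h' => h (Fin.succ_injective _ h')]
  simp [this]

lemma matchSum_succ (B : Fin (n + 1) → Matrix m m ℂ) (i j : Fin (n + 1) → m)
    (π : Equiv.Perm (Fin n)) :
    matchSum B i j (Equiv.Perm.decomposeFin.symm (0, π)) =
      (if i 0 = j 0 then (B 0).trace else 0) *
        matchSum (fun k => B k.succ) (fun k => i k.succ) (fun k => j k.succ) π +
      ∑ a : Fin n, (if i a.succ = j 0 then 1 else 0) *
        matchSum (Function.update (fun k => B k.succ) a (B 0 * B a.succ))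
          (Function.update (fun k => i k.succ) a (i 0)) (fun k => j k.succ) π := by
  unfold matchSum
  rw [← Equiv.Perm.decomposeFin.symm.sum_comp, ← Finset.univ_product_univ, Finset.sum_product,
    Fin.sum_univ_succ]
  congr 1
  · rw [Finset.mul_sum]
    refine Finset.sum_congr rfl fun e _ => ?_
    rw [permSum_decomposeFin_zero, if_congr (comp_decomposeFin_zero i j e π) rfl rfl, ite_and]
    split_ifs <;> simp
  · refine Finset.sum_congr rfl fun a _ => ?_
    rw [Finset.mul_sum]
    refine Finset.sum_congr rfl fun e _ => ?_
    rw [permSum_decomposeFin_succ, if_congr (comp_decomposeFin_succ i j a e π) rfl rfl, ite_and]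
    split_ifs <;> simp

lemma summable_wordSum (x : ℂ) (hx : (n : ℝ) ^ 2 * ‖x‖ < 1) (B : Fin n → Matrix m m ℂ)
    (i j : Fin n → m) : Summable fun L : Word (revKey : Fin n → ℕ) =>
      x ^ L.1.length * matchSum B i j (swapProd L.1) := by
  obtain ⟨K, hK⟩ := (Set.finite_range fun π : Equiv.Perm (Fin n) =>
    ‖matchSum B i j π‖).bddAbove
  have h1 : Summable fun L : List (Fin n × Fin n) => ‖x‖ ^ L.length :=
    summable_list_pow ‖x‖ (norm_nonneg _) (by
      rw [Fintype.card_prod, Fintype.card_fin]; push_cast; nlinarith)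
  refine Summable.of_norm_bounded ((h1.subtype _).mul_right K) fun L => ?_
  rw [norm_mul, norm_pow]
  exact mul_le_mul_of_nonneg_left (hK ⟨swapProd L.1, rfl⟩) (by positivity)

lemma wordSum_succ (x : ℂ) (hx : ((n + 1 : ℕ) : ℝ) ^ 2 * ‖x‖ < 1)
    (B : Fin (n + 1) → Matrix m m ℂ) (i j : Fin (n + 1) → m) :
    wordSum x B i j = (if i 0 = j 0 then (B 0).trace else 0) *
        wordSum x (fun k => B k.succ) (fun k => i k.succ) (fun k => j k.succ) +
      ∑ a : Fin n, (if i a.succ = j 0 then 1 else 0) *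
        wordSum x (Function.update (fun k => B k.succ) a (B 0 * B a.succ))
          (Function.update (fun k => i k.succ) a (i 0)) (fun k => j k.succ) +
      x * ∑ a : Fin n, wordSum x B i (j ∘ Equiv.swap 0 a.succ) := by
  have hx' : (n : ℝ) ^ 2 * ‖x‖ < 1 := by
    refine lt_of_le_of_lt (mul_le_mul_of_nonneg_right ?_ (norm_nonneg _)) hx
    gcongr
    omega
  have hs := summable_wordSum x hx B i j
  have hs' := (Equiv.ofBijective _ (wordCons_bijective (n := n))).summable_iff.2 hs
  have h1 : ∀ L : Word (revKey : Fin n → ℕ),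
      x ^ (wordCons (Sum.inl L)).1.length * matchSum B i j (swapProd (wordCons (Sum.inl L)).1) =
      (if i 0 = j 0 then (B 0).trace else 0) *
        (x ^ L.1.length *
          matchSum (fun k => B k.succ) (fun k => i k.succ) (fun k => j k.succ) (swapProd L.1)) +
      ∑ a : Fin n, (if i a.succ = j 0 then 1 else 0) * (x ^ L.1.length *
        matchSum (Function.update (fun k => B k.succ) a (B 0 * B a.succ))
          (Function.update (fun k => i k.succ) a (i 0)) (fun k => j k.succ) (swapProd L.1)) := by
    intro L
    have : (wordCons (Sum.inl L)).1 = succList L.1 := rfl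
    rw [this, swapProd_succList, matchSum_succ, mul_add, Finset.mul_sum, succList, List.length_map]
    congr 1
    · ring
    · exact Finset.sum_congr rfl fun _ _ => by ring
  have h2 : ∀ q : Fin n × Word (revKey : Fin (n + 1) → ℕ),
      x ^ (wordCons (Sum.inr q)).1.length * matchSum B i j (swapProd (wordCons (Sum.inr q)).1) =
      x * (x ^ q.2.1.length * matchSum B i (j ∘ Equiv.swap 0 q.1.succ) (swapProd q.2.1)) := by
    intro q
    have : (wordCons (Sum.inr q)).1 = q.2.1 ++ [(q.1.succ, 0)] := rfl
    rw [this, swapProd_append, matchSum_mul_swap, List.length_append, List.length_singleton,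
      pow_succ, Equiv.swap_comm]
    ring
  rw [wordSum, ← (Equiv.ofBijective _ (wordCons_bijective (n := n))).tsum_eq]
  refine (Summable.tsum_sum (hs'.comp_injective Sum.inl_injective)
    (hs'.comp_injective Sum.inr_injective)).trans ?_
  simp only [Function.comp_apply, Equiv.ofBijective_apply, h1, h2]
  congr 1
  · rw [Summable.tsum_add, tsum_mul_left, Summable.tsum_finsetSum]
    · simp only [tsum_mul_left, wordSum]
    · exact fun a _ => (summable_wordSum x hx' _ _ _).mul_left _
    · exact (summable_wordSum x hx' _ _ _).mul_left _
    · exact summable_sum fun a _ => (summable_wordSum x hx' _ _ _).mul_left _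
  · have hs2 : Summable fun q : Fin n × Word (revKey : Fin (n + 1) → ℕ) =>
      x * (x ^ q.2.1.length * matchSum B i (j ∘ Equiv.swap 0 q.1.succ) (swapProd q.2.1)) := by
      refine (hs'.comp_injective Sum.inr_injective).congr fun q => ?_
      exact h2 q
    rw [hs2.tsum_prod, tsum_fintype, Finset.mul_sum]
    simp only [tsum_mul_left, wordSum]

end WordSum

section Unitary

variable {N : ℕ}

instance : CompactSpace (unitaryGroup (Fin N) ℂ) := by
  have h1 : IsCompact (Set.univ.pi fun _ : Fin N => Set.univ.pi fun _ : Fin N =>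
      Metric.closedBall (0 : ℂ) 1) :=
    isCompact_univ_pi fun _ => isCompact_univ_pi fun _ => isCompact_closedBall 0 1
  have h2 : IsClosed (unitaryGroup (Fin N) ℂ : Set (Matrix (Fin N) (Fin N) ℂ)) := by
    have : (unitaryGroup (Fin N) ℂ : Set (Matrix (Fin N) (Fin N) ℂ)) =
        {U | U * star U = 1} := by
      ext U
      exact mem_unitaryGroup_iff
    rw [this]
    exact isClosed_eq (continuous_id.mul continuous_star) continuous_const
  refine isCompact_iff_compactSpace.1 (h1.of_isClosed_subset h2 fun U hU => ?_)
  simp only [Set.mem_pi, Set.mem_univ, true_imp_iff, mem_closedBall_zero_iff]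
  exact fun i j => entry_norm_bound_of_unitary hU i j

open scoped Matrix.Norms.L2Operator in
lemma exists_unitary_curve (H : selfAdjoint (Matrix (Fin N) (Fin N) ℂ)) :
    ∃ V : ℝ → unitaryGroup (Fin N) ℂ, V 0 = 1 ∧ ∀ p q,
      HasDerivAt (fun t => (V t : Matrix (Fin N) (Fin N) ℂ) p q) (Complex.I * H.1 p q) 0 := by
  refine ⟨fun t => selfAdjoint.expUnitary (t • H), by simp, fun p q => ?_⟩
  have h := hasDerivAt_exp_smul_const (𝕂 := ℝ) (Complex.I • H.1) (0 : ℝ)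
  have h2 := (LinearMap.toContinuousLinearMap
    (Matrix.entryLinearMap ℝ ℂ p q)).hasFDerivAt.comp_hasDerivAt (0 : ℝ) h
  convert! h2 using 1
  · ext t
    change NormedSpace.exp (Complex.I • t • H.1) p q = NormedSpace.exp (t • Complex.I • H.1) p q
    rw [smul_comm]
  · change _ = (NormedSpace.exp ((0 : ℝ) • Complex.I • H.1) * Complex.I • H.1) p q
    simp

end Unitary

section Tensor

variable {N n : ℕ}

lemma sum_prod_erase_mul (i : Fin n → Fin N) (k : Fin n) (g : (Fin n → Fin N) → ℂ) :
    ∑ a : Fin n → Fin N, (∏ l ∈ Finset.univ.erase k, (1 : Matrix (Fin N) (Fin N) ℂ) (i l) (a l)) *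
      g a = ∑ c, g (Function.update i k c) := by
  have h : ∀ a : Fin n → Fin N,
      (∏ l ∈ Finset.univ.erase k, (1 : Matrix (Fin N) (Fin N) ℂ) (i l) (a l)) =
      ∑ c, if a = Function.update i k c then 1 else 0 := by
    intro a
    have h1 : ∀ c, a = Function.update i k c ↔ a k = c ∧ ∀ l ∈ Finset.univ.erase k, i l = a l := by
      intro c
      constructor
      · rintro rfl
        refine ⟨by simp, fun l hl => ?_⟩
        rw [Function.update_of_ne (Finset.ne_of_mem_erase hl)]
      · rintro ⟨rfl, h⟩
        ext l
        rcases eq_or_ne l k with rfl | hl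
        · simp
        · rw [Function.update_of_ne hl, h l (Finset.mem_erase.2 ⟨hl, Finset.mem_univ _⟩)]
    simp only [h1, ite_and, Finset.sum_ite_eq, Finset.mem_univ, if_true, Matrix.one_apply]
    rw [Finset.prod_ite_zero]
    simp
  simp only [h, Finset.sum_mul]
  rw [Finset.sum_comm]
  simp

/-- The infinitesimal action of the matrix `K` on the tensor `T`. -/
noncomputable def lieAction (T : (Fin n → Fin N) → (Fin n → Fin N) → ℂ)
    (i j : Fin n → Fin N) (K : Matrix (Fin N) (Fin N) ℂ) : ℂ :=
  ∑ k, ∑ c, (K (i k) c * T (Function.update i k c) j - K c (j k) * T i (Function.update j k c))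

lemma lieAction_add (T : (Fin n → Fin N) → (Fin n → Fin N) → ℂ) (i j : Fin n → Fin N)
    (K L : Matrix (Fin N) (Fin N) ℂ) :
    lieAction T i j (K + L) = lieAction T i j K + lieAction T i j L := by
  simp only [lieAction, ← Finset.sum_add_distrib, Matrix.add_apply]
  exact Finset.sum_congr rfl fun _ _ => Finset.sum_congr rfl fun _ _ => by ring

lemma lieAction_smul (T : (Fin n → Fin N) → (Fin n → Fin N) → ℂ) (i j : Fin n → Fin N)
    (z : ℂ) (K : Matrix (Fin N) (Fin N) ℂ) :
    lieAction T i j (z • K) = z * lieAction T i j K := by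
  simp only [lieAction, Finset.mul_sum, Matrix.smul_apply, smul_eq_mul]
  exact Finset.sum_congr rfl fun _ _ => Finset.sum_congr rfl fun _ _ => by ring

/-- The tensor `T` is invariant under conjugation by unitary matrices. -/
def ConjInvariant (T : (Fin n → Fin N) → (Fin n → Fin N) → ℂ) : Prop :=
  ∀ (V : unitaryGroup (Fin N) ℂ) i j, T i j = ∑ a : Fin n → Fin N, ∑ b : Fin n → Fin N,
    (∏ l, V.1 (i l) (a l)) * (∏ l, star (V.1 (j l) (b l))) * T a b

lemma ConjInvariant.lieAction_eq_zero {T : (Fin n → Fin N) → (Fin n → Fin N) → ℂ}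
    (hT : ConjInvariant T) (i j : Fin n → Fin N) (K : Matrix (Fin N) (Fin N) ℂ) :
    lieAction T i j K = 0 := by
  have key : ∀ H : selfAdjoint (Matrix (Fin N) (Fin N) ℂ), lieAction T i j H.1 = 0 := by
    intro H
    obtain ⟨V, hV0, hV⟩ := exists_unitary_curve H
    have hV1 : (V 0).1 = 1 := by rw [hV0]; rfl
    have h6 : ∀ p q, star ((1 : Matrix (Fin N) (Fin N) ℂ) p q) =
        (1 : Matrix (Fin N) (Fin N) ℂ) p q := fun p q => by
      rw [Matrix.one_apply]; split_ifs <;> simp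
    have h1 : ∀ a : Fin n → Fin N, HasDerivAt (fun t => ∏ l, (V t).1 (i l) (a l))
        (∑ k, (∏ l ∈ Finset.univ.erase k, (1 : Matrix (Fin N) (Fin N) ℂ) (i l) (a l)) *
          (Complex.I * H.1 (i k) (a k))) 0 := fun a => by
      have := HasDerivAt.fun_finsetProd (u := Finset.univ) fun l _ => hV (i l) (a l)
      simpa only [hV1, smul_eq_mul] using this
    have h2 : ∀ b : Fin n → Fin N, HasDerivAt (fun t => ∏ l, star ((V t).1 (j l) (b l)))
        (∑ k, (∏ l ∈ Finset.univ.erase k, (1 : Matrix (Fin N) (Fin N) ℂ) (j l) (b l)) *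
          (-Complex.I * H.1 (b k) (j k))) 0 := fun b => by
      have := HasDerivAt.fun_finsetProd (u := Finset.univ) fun l _ => (hV (j l) (b l)).star
      have h3 : ∀ p q, star (H.1 p q) = H.1 q p := fun p q => by
        have := congrFun (congrFun H.2 q) p
        exact this
      simpa only [hV1, smul_eq_mul, star_mul', h3, h6, Complex.star_def, Complex.conj_I] using this
    have e1 : ∀ (p : Fin n → Fin N) (f : Fin n → Fin N → ℂ) (g : (Fin n → Fin N) → ℂ),
        ∑ a : Fin n → Fin N, (∑ k, (∏ l ∈ Finset.univ.erase k,
          (1 : Matrix (Fin N) (Fin N) ℂ) (p l) (a l)) * f k (a k)) * g a =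
        ∑ k, ∑ c, f k c * g (Function.update p k c) := by
      intro p f g
      simp only [Finset.sum_mul, mul_assoc]
      rw [Finset.sum_comm]
      refine Finset.sum_congr rfl fun k _ => ?_
      rw [sum_prod_erase_mul p k fun a => f k (a k) * g a]
      simp
    have e2 : ∀ (p : Fin n → Fin N) (g : (Fin n → Fin N) → ℂ),
        ∑ a : Fin n → Fin N, (∏ l, (1 : Matrix (Fin N) (Fin N) ℂ) (p l) (a l)) * g a = g p := by
      intro p g
      simp only [Matrix.one_apply, Finset.prod_ite_zero]
      rw [Finset.sum_eq_single p]
      · simp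
      · intro b _ hb
        rw [if_neg fun h => hb (funext fun l => (h l (Finset.mem_univ _)).symm), zero_mul]
      · simp
    have h3 := HasDerivAt.fun_sum (u := Finset.univ) fun a _ =>
      HasDerivAt.fun_sum (u := Finset.univ) fun b _ => ((h1 a).mul (h2 b)).mul_const (T a b)
    have h4 : HasDerivAt (fun _ : ℝ => T i j) 0 0 := hasDerivAt_const _ _
    have h5 := h4.unique (h3.congr_of_eventuallyEq (Filter.Eventually.of_forall fun t => hT (V t) i j))
    simp only [hV1, h6, add_mul, Finset.sum_add_distrib] at h5
    have h7 : ∀ a b, (∑ k, (∏ l ∈ Finset.univ.erase k, (1 : Matrix (Fin N) (Fin N) ℂ) (i l) (a l)) *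
          (Complex.I * H.1 (i k) (a k))) * (∏ l, (1 : Matrix (Fin N) (Fin N) ℂ) (j l) (b l)) * T a b
        = (∏ l, (1 : Matrix (Fin N) (Fin N) ℂ) (j l) (b l)) *
          ((∑ k, (∏ l ∈ Finset.univ.erase k, (1 : Matrix (Fin N) (Fin N) ℂ) (i l) (a l)) *
          (Complex.I * H.1 (i k) (a k))) * T a b) := fun a b => by ring
    simp only [h7, e2] at h5
    rw [e1 i (fun k c => Complex.I * H.1 (i k) c) fun a => T a j] at h5
    simp only [mul_assoc, ← Finset.mul_sum, e2] at h5
    rw [e1 j (fun k c => -Complex.I * H.1 c (j k)) fun b => T i b] at h5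
    have h8 : Complex.I * lieAction T i j H.1 = 0 := by
      rw [h5, lieAction]
      simp only [Finset.mul_sum, ← Finset.sum_add_distrib]
      exact Finset.sum_congr rfl fun k _ => Finset.sum_congr rfl fun c _ => by ring
    exact (mul_eq_zero.1 h8).resolve_left Complex.I_ne_zero
  have hK := realPart_add_I_smul_imaginaryPart K
  rw [← hK, lieAction_add, lieAction_smul, key, key]
  simp

end Tensor

section Haar

variable {N : ℕ}

/-- The conjugate of the matrix `B` by the unitary matrix `U`. -/
noncomputable def conjMat (B : Matrix (Fin N) (Fin N) ℂ) (U : unitaryGroup (Fin N) ℂ) :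
    Matrix (Fin N) (Fin N) ℂ :=
  U.1 * B * (U⁻¹).1

lemma conjMat_mul_conjMat (B C : Matrix (Fin N) (Fin N) ℂ) (U : unitaryGroup (Fin N) ℂ) :
    conjMat B U * conjMat C U = conjMat (B * C) U := by
  have h : (U⁻¹).1 * U.1 = 1 := by
    rw [← Submonoid.coe_mul, inv_mul_cancel]; rfl
  unfold conjMat
  calc _ = U.1 * B * ((U⁻¹).1 * U.1) * C * (U⁻¹).1 := by simp only [Matrix.mul_assoc]
    _ = _ := by rw [h]; simp only [Matrix.mul_assoc, Matrix.one_mul]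

lemma trace_conjMat (B : Matrix (Fin N) (Fin N) ℂ) (U : unitaryGroup (Fin N) ℂ) :
    (conjMat B U).trace = B.trace := by
  have h : (U⁻¹).1 * U.1 = 1 := by
    rw [← Submonoid.coe_mul, inv_mul_cancel]; rfl
  rw [conjMat, Matrix.trace_mul_comm, ← Matrix.mul_assoc, h, Matrix.one_mul]

lemma conjMat_mul_apply (B : Matrix (Fin N) (Fin N) ℂ) (V U : unitaryGroup (Fin N) ℂ)
    (p q : Fin N) : conjMat B (V * U) p q =
      ∑ a, ∑ b, V.1 p a * star (V.1 q b) * conjMat B U a b := by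
  have h : conjMat B (V * U) = V.1 * conjMat B U * star V.1 := by
    unfold conjMat
    rw [_root_.mul_inv_rev, Submonoid.coe_mul, Submonoid.coe_mul, UnitaryGroup.inv_val V]
    simp only [Matrix.mul_assoc]
  rw [h, Matrix.mul_apply]
  simp only [Matrix.mul_apply, Finset.sum_mul]
  rw [Finset.sum_comm]
  refine Finset.sum_congr rfl fun a _ => Finset.sum_congr rfl fun b _ => ?_
  rw [Matrix.star_apply]
  ring

lemma continuous_conjMat (B : Matrix (Fin N) (Fin N) ℂ) : Continuous (conjMat B) := by
  have h : conjMat B = fun U => U.1 * B * star U.1 := by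
    ext U : 1
    rw [conjMat, UnitaryGroup.inv_val]
  rw [h]
  exact (continuous_subtype_val.mul continuous_const).mul
    (continuous_star.comp continuous_subtype_val)

variable (μ : Measure (unitaryGroup (Fin N) ℂ)) [IsProbabilityMeasure μ]

lemma integrable_of_continuous {f : unitaryGroup (Fin N) ℂ → ℂ} (hf : Continuous f) :
    Integrable f μ :=
  hf.integrable_of_hasCompactSupport (HasCompactSupport.of_compactSpace f)

/-- The integral of products of entries of conjugates of the matrices `B l`. -/
noncomputable def haarTensor {n : ℕ} (μ : Measure (unitaryGroup (Fin N) ℂ))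
    (B : Fin n → Matrix (Fin N) (Fin N) ℂ) (i j : Fin n → Fin N) : ℂ :=
  ∫ U, ∏ l, conjMat (B l) U (i l) (j l) ∂μ

lemma integrable_haarTensor {n : ℕ} (B : Fin n → Matrix (Fin N) (Fin N) ℂ)
    (i j : Fin n → Fin N) : Integrable (fun U => ∏ l, conjMat (B l) U (i l) (j l)) μ := by
  refine integrable_of_continuous μ (continuous_finsetProd _ fun l _ => ?_)
  exact (continuous_conjMat (B l)).matrix_elem _ _

lemma conjInvariant_haarTensor [μ.IsMulLeftInvariant] {n : ℕ}
    (B : Fin n → Matrix (Fin N) (Fin N) ℂ) : ConjInvariant (haarTensor μ B) := by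
  intro V i j
  have h1 : ∀ U, ∏ l, conjMat (B l) (V * U) (i l) (j l) =
      ∑ a : Fin n → Fin N, ∑ b : Fin n → Fin N,
        (∏ l, V.1 (i l) (a l)) * (∏ l, star (V.1 (j l) (b l))) *
          ∏ l, conjMat (B l) U (a l) (b l) := by
    intro U
    simp only [conjMat_mul_apply, Finset.prod_univ_sum, Fintype.piFinset_univ,
      Finset.prod_mul_distrib]
  unfold haarTensor
  rw [← integral_mul_left_eq_self _ V]
  simp only [h1]
  rw [integral_finsetSum]
  · refine Finset.sum_congr rfl fun a _ => ?_
    rw [integral_finsetSum]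
    · exact Finset.sum_congr rfl fun b _ => integral_const_mul _ _
    · exact fun b _ => (integrable_haarTensor μ B a b).const_mul _
  · exact fun a _ => integrable_finsetSum _ fun b _ =>
      (integrable_haarTensor μ B a b).const_mul _

variable {n : ℕ} (B : Fin (n + 1) → Matrix (Fin N) (Fin N) ℂ) (i j : Fin (n + 1) → Fin N)

lemma sum_haarTensor_zero : ∑ q, haarTensor μ B (Function.update i 0 q) (Function.update j 0 q) =
    (B 0).trace * haarTensor μ (fun k => B k.succ) (fun k => i k.succ) (fun k => j k.succ) := by
  unfold haarTensor
  rw [← integral_finsetSum _ fun q _ => integrable_haarTensor μ B _ _, ← integral_const_mul]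
  congr 1
  ext U
  rw [← trace_conjMat (B 0) U, Matrix.trace, Finset.sum_mul]
  refine Finset.sum_congr rfl fun q _ => ?_
  rw [Fin.prod_univ_succ]
  simp

lemma sum_haarTensor_succ (a : Fin n) :
    ∑ q, haarTensor μ B (Function.update i a.succ q) (Function.update j 0 q) =
    haarTensor μ (Function.update (fun k => B k.succ) a (B 0 * B a.succ))
      (Function.update (fun k => i k.succ) a (i 0)) (fun k => j k.succ) := by
  unfold haarTensor
  rw [← integral_finsetSum _ fun q _ => integrable_haarTensor μ B _ _]
  congr 1
  ext U
  rw [← Finset.mul_prod_erase _ _ (Finset.mem_univ a), Function.update_self, Function.update_self,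
    ← conjMat_mul_conjMat, Matrix.mul_apply, Finset.sum_mul]
  refine Finset.sum_congr rfl fun q _ => ?_
  rw [Fin.prod_univ_succ, ← Finset.mul_prod_erase _ _ (Finset.mem_univ a), ← mul_assoc]
  congr 1
  · simp [Function.update_of_ne (Fin.succ_ne_zero a).symm]
  · refine Finset.prod_congr rfl fun k hk => ?_
    have hk : k ≠ a := Finset.ne_of_mem_erase hk
    simp [Function.update_of_ne hk, Function.update_of_ne ((Fin.succ_injective n).ne hk)]

lemma haarTensor_succ [μ.IsMulLeftInvariant] :
    N * haarTensor μ B i j + ∑ a : Fin n, haarTensor μ B i (j ∘ Equiv.swap 0 a.succ) =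
      (if i 0 = j 0 then (B 0).trace else 0) *
        haarTensor μ (fun k => B k.succ) (fun k => i k.succ) (fun k => j k.succ) +
      ∑ a : Fin n, (if i a.succ = j 0 then 1 else 0) *
        haarTensor μ (Function.update (fun k => B k.succ) a (B 0 * B a.succ))
          (Function.update (fun k => i k.succ) a (i 0)) (fun k => j k.succ) := by
  set T := haarTensor μ B with hT
  have h1 : ∀ q, ∑ k, (if i k = j 0 then 1 else 0) *
        T (Function.update i k q) (Function.update j 0 q) =
      ∑ k, (if Function.update j 0 q k = q then 1 else 0) *
        T i (Function.update (Function.update j 0 q) k (j 0)) := by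
    intro q
    have := (conjInvariant_haarTensor μ B).lieAction_eq_zero i (Function.update j 0 q)
      (Matrix.single (j 0) q 1)
    rw [lieAction] at this
    simp only [Finset.sum_sub_distrib, sub_eq_zero, Matrix.single_apply, ← hT] at this
    simpa [ite_and, eq_comm] using this
  have h2 := Finset.sum_congr (rfl : (Finset.univ : Finset (Fin N)) = _) fun q _ => h1 q
  rw [Finset.sum_comm, Finset.sum_comm (f := fun q k => (if Function.update j 0 q k = q then 1 else 0) *
        T i (Function.update (Function.update j 0 q) k (j 0))), Fin.sum_univ_succ,
      Fin.sum_univ_succ] at h2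
  simp only [← Finset.mul_sum, hT, sum_haarTensor_zero, sum_haarTensor_succ] at h2
  have h3 : ∀ a : Fin n, ∑ q, (if Function.update j 0 q a.succ = q then 1 else 0) *
      haarTensor μ B i (Function.update (Function.update j 0 q) a.succ (j 0)) =
      haarTensor μ B i (j ∘ Equiv.swap 0 a.succ) := by
    intro a
    have : Function.update (Function.update j 0 (j a.succ)) a.succ (j 0) =
        j ∘ Equiv.swap 0 a.succ := by
      ext k : 1
      rcases eq_or_ne k 0 with rfl | h0
      · simp [Function.update_of_ne (Fin.succ_ne_zero a).symm]
      · rcases eq_or_ne k a.succ with rfl | h1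
        · simp
        · simp [h0, h1, Equiv.swap_apply_of_ne_of_ne h0 h1]
    simp [this]
  simp only [h3] at h2
  simp only [Function.update_self, Function.update_idem, Function.update_eq_self, if_true, one_mul,
    Finset.sum_const, Finset.card_univ, Fintype.card_fin, nsmul_eq_mul] at h2
  rw [hT, ← h2]
  congr 1
  split_ifs <;> simp

end Haar

lemma eq_zero_of_swap_sum {N n : ℕ} (hN : n < N) (f : (Fin (n + 1) → Fin N) → ℂ)
    (hf : ∀ j, (N : ℂ) * f j + ∑ a : Fin n, f (j ∘ Equiv.swap 0 a.succ) = 0) (j) : f j = 0 := by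
  obtain ⟨j₀, -, hj₀⟩ := Finset.exists_max_image Finset.univ (fun j => ‖f j‖) ⟨j, Finset.mem_univ _⟩
  have h1 : ‖(N : ℂ) * f j₀‖ ≤ n * ‖f j₀‖ := by
    rw [eq_neg_of_add_eq_zero_left (hf j₀), norm_neg]
    refine (norm_sum_le _ _).trans ((Finset.sum_le_sum fun a _ => hj₀ _ (Finset.mem_univ _)).trans ?_)
    simp
  have h2 : ‖f j₀‖ = 0 := by
    rw [norm_mul, Complex.norm_natCast] at h1
    have : (n : ℝ) < N := by exact_mod_cast hN
    nlinarith [norm_nonneg (f j₀)]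
  exact norm_eq_zero.1 (le_antisymm (h2 ▸ hj₀ j (Finset.mem_univ _)) (norm_nonneg _))

lemma haarTensor_eq {N : ℕ} (μ : Measure (unitaryGroup (Fin N) ℂ)) [IsProbabilityMeasure μ]
    [μ.IsMulLeftInvariant] (n : ℕ) (hN : n ^ 2 < N) (B : Fin n → Matrix (Fin N) (Fin N) ℂ)
    (i j : Fin n → Fin N) :
    haarTensor μ B i j = ((N : ℂ)⁻¹) ^ n * wordSum (-(N : ℂ)⁻¹) B i j := by
  have hN0 : (N : ℂ) ≠ 0 := Nat.cast_ne_zero.2 (by omega)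
  have hx : ∀ n : ℕ, n ^ 2 < N → (n : ℝ) ^ 2 * ‖-(N : ℂ)⁻¹‖ < 1 := by
    intro n hn
    rw [norm_neg, norm_inv, Complex.norm_natCast, ← div_eq_mul_inv, div_lt_one]
    · exact_mod_cast hn
    · exact_mod_cast (Nat.zero_le _).trans_lt hn
  induction n with
  | zero =>
    have hu : Unique (Word (revKey : Fin 0 → ℕ)) :=
      { default := ⟨[], by simp [IsWord]⟩
        uniq := fun L => Subtype.ext (by
          rcases L with ⟨_ | ⟨q, _⟩, _⟩
          · rfl
          · exact q.1.elim0) }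
    rw [wordSum, tsum_eq_single (⟨[], by simp [IsWord]⟩ : Word (revKey : Fin 0 → ℕ))
      fun L hL => absurd (Subsingleton.elim _ _) hL]
    have h : ∀ π : Equiv.Perm (Fin 0), i ∘ π = j := fun π => Subsingleton.elim _ _
    simp [haarTensor, matchSum, permSum, swapProd, h]
  | succ n ih =>
    have hn : n ^ 2 < N := lt_of_le_of_lt (by gcongr; omega) hN
    have hn' : n < N := by nlinarith
    rw [← sub_eq_zero]
    revert j
    refine eq_zero_of_swap_sum hn' _ fun j => ?_
    have h1 := haarTensor_succ μ B i j
    have h2 := wordSum_succ _ (hx _ hN) B i j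
    simp only [ih hn] at h1
    rw [Finset.sum_sub_distrib, ← Finset.mul_sum, mul_sub]
    have h3 : (N : ℂ) * (N : ℂ)⁻¹ = 1 := mul_inv_cancel₀ hN0
    simp only [mul_left_comm _ ((N : ℂ)⁻¹ ^ n), ← Finset.mul_sum, ← mul_add] at h1
    linear_combination h1 - (N : ℂ)⁻¹ ^ n * h2 -
      (N : ℂ)⁻¹ ^ n * wordSum (-(N : ℂ)⁻¹) B i j * h3

lemma tsum_fintype_prod {γ β : Type} [Fintype γ] (f : γ × β → ℂ) (hf : Summable f) :
    ∑' q, f q = ∑' b, ∑ c, f (c, b) := by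
  have h : Summable fun q => f (Equiv.prodComm β γ q) := (Equiv.prodComm β γ).summable_iff.2 hf
  rw [← (Equiv.prodComm β γ).tsum_eq, h.tsum_prod]
  exact tsum_congr fun b => tsum_fintype _

lemma prod_apply_eq_permSum_inv {α n : Type} [Fintype α] [Fintype n] [DecidableEq α]
    (A : Matrix n n ℂ) (τ : Equiv.Perm α) :
    ∑ i : α → n, ∏ l, A (i (τ l)) (i l) = permSum (fun _ => A) τ⁻¹ := by
  unfold permSum
  refine Finset.sum_congr rfl fun i _ => ?_
  rw [← Equiv.prod_comp τ fun k => A (i k) (i (τ⁻¹ k))]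
  simp

lemma sum_matchSum {n m : ℕ} (A B : Matrix (Fin m) (Fin m) ℂ) (π : Equiv.Perm (Fin n)) :
    ∑ i : Fin n → Fin m, ∑ j : Fin n → Fin m,
      (∏ l, A (j l) (i l)) * matchSum (fun _ => B) i j π =
      ∑ σ : Equiv.Perm (Fin n), permSum (fun _ => A) (σ * π)⁻¹ * permSum (fun _ => B) σ := by
  simp only [← prod_apply_eq_permSum_inv, Finset.sum_mul]
  rw [Finset.sum_comm (s := (Finset.univ : Finset (Equiv.Perm (Fin n))))]
  refine Finset.sum_congr rfl fun i _ => ?_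
  simp only [matchSum, Finset.mul_sum]
  rw [Finset.sum_comm]
  refine Finset.sum_congr rfl fun σ _ => ?_
  rw [Finset.sum_eq_single (i ∘ (σ * π : Equiv.Perm (Fin n)))]
  · simp
  · exact fun j _ hj => by rw [if_neg hj.symm, mul_zero]
  · exact fun h => absurd (Finset.mem_univ _) h

lemma sum_wordSum {n m : ℕ} (x : ℂ) (hx : (n : ℝ) ^ 2 * ‖x‖ < 1)
    (A B : Matrix (Fin m) (Fin m) ℂ) :
    ∑ i : Fin n → Fin m, ∑ j : Fin n → Fin m,
      (∏ l, A (j l) (i l)) * wordSum x (fun _ => B) i j =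
      fullSeries x A B (Fin.val : Fin n → ℕ) := by
  have hs := summable_wordSum x hx (fun _ : Fin n => B)
  have h1 : fullSeries x A B (Fin.val : Fin n → ℕ) = fullSeries x A B (revKey : Fin n → ℕ) := by
    refine fullSeries_map x A B Fin.revPerm fun a b => ?_
    rw [revKey_lt, ← Fin.lt_def, Fin.revPerm_apply, Fin.revPerm_apply, Fin.rev_lt_rev]
  rw [h1, fullSeries, tsum_fintype_prod _ (summable_wordWeight x A B _ (by simpa using hx)).of_norm]
  simp only [wordSum, ← tsum_mul_left]
  simp_rw [← Summable.tsum_finsetSum fun j _ => (hs _ j).mul_left _]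
  rw [← Summable.tsum_finsetSum fun i _ => summable_sum fun j _ => (hs i j).mul_left _]
  refine tsum_congr fun L => ?_
  simp only [mul_left_comm _ (x ^ _), ← Finset.mul_sum, sum_matchSum]
  simp only [Finset.mul_sum, wordWeight, mul_assoc]

lemma trace_mul_conjMat_pow {N : ℕ} (n : ℕ) (A B : Matrix (Fin N) (Fin N) ℂ)
    (U : unitaryGroup (Fin N) ℂ) :
    (A * U.1 * B * (U⁻¹).1).trace ^ n =
      ∑ i : Fin n → Fin N, ∑ j : Fin n → Fin N,
        (∏ l, A (j l) (i l)) * ∏ l, conjMat B U (i l) (j l) := by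
  have h : (A * U.1 * B * (U⁻¹).1).trace = ∑ p, ∑ q, A q p * conjMat B U p q := by
    rw [Matrix.mul_assoc A, Matrix.mul_assoc A, Finset.sum_comm]
    rfl
  rw [h, ← Fin.prod_const]
  simp only [Finset.prod_univ_sum, Fintype.piFinset_univ, Finset.prod_mul_distrib]

lemma integral_trace_pow {N : ℕ} (μ : Measure (unitaryGroup (Fin N) ℂ)) [IsProbabilityMeasure μ]
    [μ.IsMulLeftInvariant] (n : ℕ) (hN : n ^ 2 < N) (A B : Matrix (Fin N) (Fin N) ℂ) :
    ∫ U : unitaryGroup (Fin N) ℂ, (A * U.1 * B * (U⁻¹).1).trace ^ n ∂μ =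
      (N : ℂ)⁻¹ ^ n * fullSeries (-(N : ℂ)⁻¹) A B (Fin.val : Fin n → ℕ) := by
  have hx : (n : ℝ) ^ 2 * ‖-(N : ℂ)⁻¹‖ < 1 := by
    rw [norm_neg, norm_inv, Complex.norm_natCast, ← div_eq_mul_inv, div_lt_one]
    · exact_mod_cast hN
    · exact_mod_cast (Nat.zero_le _).trans_lt hN
  simp only [trace_mul_conjMat_pow]
  rw [integral_finsetSum]
  · rw [← sum_wordSum _ hx, Finset.mul_sum]
    refine Finset.sum_congr rfl fun i _ => ?_
    rw [integral_finsetSum, Finset.mul_sum]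
    · refine Finset.sum_congr rfl fun j _ => ?_
      rw [integral_const_mul, mul_left_comm, ← haarTensor_eq μ n hN]
      rfl
    · exact fun j _ => (integrable_haarTensor μ _ i j).const_mul _
  · exact fun i _ => integrable_finsetSum _ fun j _ =>
      (integrable_haarTensor μ (fun _ => B) i j).const_mul _

lemma hasDerivAt_integral_pow_mul_exp {X : Type} [TopologicalSpace X] [CompactSpace X]
    [MeasurableSpace X] (μ : Measure X) [IsFiniteMeasure μ]
    (t : X → ℂ) (ht : Continuous t) (hInt : ∀ f : X → ℂ, Continuous f → Integrable f μ)
    (k : ℕ) (z : ℂ) :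
    HasDerivAt (fun w => ∫ a, t a ^ k * Complex.exp (w * t a) ∂μ)
      (∫ a, t a ^ (k + 1) * Complex.exp (z * t a) ∂μ) z := by
  obtain ⟨K, hK⟩ := (isCompact_univ (X := X)).exists_bound_of_continuousOn ht.continuousOn
  have hcont : ∀ (k : ℕ) (w : ℂ), Continuous fun a => t a ^ k * Complex.exp (w * t a) :=
    fun k w => by fun_prop
  refine (hasDerivAt_integral_of_dominated_loc_of_deriv_le (Metric.ball_mem_nhds z one_pos)
    (F' := fun w a => t a ^ (k + 1) * Complex.exp (w * t a))
    (bound := fun _ => K ^ (k + 1) * Real.exp ((‖z‖ + 1) * K))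
    (Filter.Eventually.of_forall fun w => (hInt _ (hcont k w)).aestronglyMeasurable)
    (hInt _ (hcont k z)) (hInt _ (hcont (k + 1) z)).aestronglyMeasurable
    (Filter.Eventually.of_forall fun a w hw => ?_) (integrable_const _)
    (Filter.Eventually.of_forall fun a w _ => ?_)).2
  · have h1 : ‖t a‖ ≤ K := hK a (Set.mem_univ a)
    have h2 : ‖w‖ ≤ ‖z‖ + 1 := by
      rw [mem_ball_iff_norm] at hw
      linarith [norm_le_norm_add_norm_sub' w z]
    rw [norm_mul, norm_pow]
    refine mul_le_mul (pow_le_pow_left₀ (norm_nonneg _) h1 _) ?_ (norm_nonneg _)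
      (pow_nonneg ((norm_nonneg _).trans h1) _)
    refine (Complex.norm_exp_le_exp_norm _).trans (Real.exp_le_exp.2 ?_)
    rw [norm_mul]
    exact mul_le_mul h2 h1 (norm_nonneg _) (by positivity)
  · have h := (((hasDerivAt_id w).mul_const (t a)).cexp).const_mul (t a ^ k)
    simp only [id_eq, one_mul] at h
    convert! h using 1
    ring

lemma iteratedDeriv_integral_exp {X : Type} [TopologicalSpace X] [CompactSpace X]
    [MeasurableSpace X] (μ : Measure X) [IsFiniteMeasure μ]
    (t : X → ℂ) (ht : Continuous t) (hInt : ∀ f : X → ℂ, Continuous f → Integrable f μ) (k : ℕ) :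
    iteratedDeriv k (fun w => ∫ a, Complex.exp (w * t a) ∂μ) =
      fun z => ∫ a, t a ^ k * Complex.exp (z * t a) ∂μ := by
  induction k with
  | zero => simp
  | succ k ih =>
    rw [iteratedDeriv_succ, ih]
    ext z
    exact (hasDerivAt_integral_pow_mul_exp μ t ht hInt k z).deriv

lemma iteratedDeriv_hciz {N : ℕ} (μ : Measure (unitaryGroup (Fin N) ℂ)) [IsProbabilityMeasure μ]
    [μ.IsMulLeftInvariant] (n : ℕ) (hN : n ^ 2 < N) (A B : Matrix (Fin N) (Fin N) ℂ) :
    iteratedDeriv n (hciz μ A B) 0 =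
      (-1) ^ n * fullSeries (-(N : ℂ)⁻¹) A B (Fin.val : Fin n → ℕ) := by
  have hN0 : (N : ℂ) ≠ 0 := Nat.cast_ne_zero.2 (by omega)
  have h1 : hciz μ A B = fun z => ∫ U : unitaryGroup (Fin N) ℂ,
      Complex.exp (z * (-(N : ℂ) * (A * U.1 * B * (U⁻¹).1).trace)) ∂μ := by
    ext z
    refine integral_congr_ae (Filter.Eventually.of_forall fun U => ?_)
    dsimp only
    congr 1
    ring
  have ht : Continuous fun U : unitaryGroup (Fin N) ℂ =>
      -(N : ℂ) * (A * U.1 * B * (U⁻¹).1).trace := by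
    simp only [Matrix.mul_assoc A]
    exact continuous_const.mul (continuous_const.matrix_mul (continuous_conjMat B)).matrix_trace
  rw [h1, iteratedDeriv_integral_exp μ _ ht (fun f hf => integrable_of_continuous μ hf)]
  simp only [zero_mul, Complex.exp_zero, mul_one, mul_pow]
  rw [integral_const_mul, integral_trace_pow μ n hN, ← mul_assoc, ← mul_pow, neg_mul,
    mul_inv_cancel₀ hN0]

lemma iteratedDeriv_succ_hciz {N : ℕ} (μ : Measure (unitaryGroup (Fin N) ℂ)) [IsProbabilityMeasure μ]
    (A B : Matrix (Fin N) (Fin N) ℂ) {ε : ℝ} {F : ℂ → ℂ} (hF : IsFreeEnergyBranch μ A B ε F)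
    (hε : 0 < ε) (n : ℕ) :
    iteratedDeriv (n + 1) (hciz μ A B) 0 = ∑ k ∈ Finset.range (n + 1),
      (n.choose k : ℂ) * ((N : ℂ) ^ 2 * iteratedDeriv (k + 1) F 0) *
        iteratedDeriv (n - k) (hciz μ A B) 0 := by
  obtain ⟨hd, h0, he⟩ := hF
  have hmem : Metric.ball (0 : ℂ) ε ∈ nhds 0 := Metric.ball_mem_nhds 0 hε
  have hev : hciz μ A B =ᶠ[nhds 0] fun z => Complex.exp ((N : ℂ) ^ 2 * F z) :=
    Filter.eventually_of_mem hmem fun z hz => (he z hz).symm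
  have hFan : AnalyticAt ℂ F 0 := hd.analyticAt hmem
  have hIan : AnalyticAt ℂ (fun z => Complex.exp ((N : ℂ) ^ 2 * F z)) 0 := by fun_prop
  have hIan' : AnalyticAt ℂ (hciz μ A B) 0 := hIan.congr hev.symm
  have hder : deriv (hciz μ A B) =ᶠ[nhds 0]
      (fun z => (N : ℂ) ^ 2 * deriv F z) * hciz μ A B := by
    filter_upwards [hev.eventuallyEq_nhds, Metric.isOpen_ball.mem_nhds
      (Metric.mem_ball_self hε)] with z hz hz'
    have hFz : HasDerivAt F (deriv F z) z :=
      (hd.differentiableAt (Metric.isOpen_ball.mem_nhds hz')).hasDerivAt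
    rw [hz.deriv_eq, ((hFz.const_mul ((N : ℂ) ^ 2)).cexp).deriv, Pi.mul_apply, hz.eq_of_nhds,
      mul_comm]
  have hF' : AnalyticAt ℂ (fun z => (N : ℂ) ^ 2 * deriv F z) 0 :=
    analyticAt_const.mul hFan.deriv
  rw [iteratedDeriv_succ', hder.iteratedDeriv_eq, iteratedDeriv_mul hF'.contDiffAt hIan'.contDiffAt]
  refine Finset.sum_congr rfl fun k _ => ?_
  rw [iteratedDeriv_const_mul_field, iteratedDeriv_succ']

lemma iteratedDeriv_freeEnergy {N : ℕ} (μ : Measure (unitaryGroup (Fin N) ℂ))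
    [IsProbabilityMeasure μ] [μ.IsMulLeftInvariant]
    (A B : Matrix (Fin N) (Fin N) ℂ) {ε : ℝ} {F : ℂ → ℂ} (hF : IsFreeEnergyBranch μ A B ε F)
    (hε : 0 < ε) (n : ℕ) (hn : (n + 1) ^ 2 < N) :
    (N : ℂ) ^ 2 * iteratedDeriv (n + 1) F 0 =
      (-1) ^ (n + 1) * connSeries (-(N : ℂ)⁻¹) A B (Fin.val : Fin (n + 1) → ℕ) := by
  induction n using Nat.strong_induction_on with
  | _ n ih =>
    have hlt : ∀ k ≤ n + 1, k ^ 2 < N := fun k hk => lt_of_le_of_lt (by gcongr) hn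
    have hx : ((n + 1 : ℕ) : ℝ) ^ 2 * ‖-(N : ℂ)⁻¹‖ < 1 := by
      rw [norm_neg, norm_inv, Complex.norm_natCast, ← div_eq_mul_inv, div_lt_one]
      · exact_mod_cast hn
      · exact_mod_cast (Nat.zero_le _).trans_lt hn
    have h1 := iteratedDeriv_succ_hciz μ A B hF hε n
    have h2 := fullSeries_succ (-(N : ℂ)⁻¹) A B n hx
    have hI0 : fullSeries (-(N : ℂ)⁻¹) A B (Fin.val : Fin 0 → ℕ) = 1 := by
      have h := iteratedDeriv_hciz μ 0 (hlt 0 (Nat.zero_le _)) A B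
      rw [iteratedDeriv_zero, ← hF.2.2 0 (Metric.mem_ball_self hε), hF.2.1] at h
      simpa using h.symm
    rw [iteratedDeriv_hciz μ _ hn, h2, Finset.mul_sum, Finset.sum_range_succ,
      Finset.sum_range_succ (n := n)] at h1
    have h3 : ∀ k ∈ Finset.range n, (n.choose k : ℂ) * ((N : ℂ) ^ 2 * iteratedDeriv (k + 1) F 0) *
        iteratedDeriv (n - k) (hciz μ A B) 0 =
        (-1) ^ (n + 1) * ((n.choose k : ℂ) *
          connSeries (-(N : ℂ)⁻¹) A B (Fin.val : Fin (k + 1) → ℕ) *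
          fullSeries (-(N : ℂ)⁻¹) A B (Fin.val : Fin (n - k) → ℕ)) := by
      intro k hk
      have hk : k < n := Finset.mem_range.1 hk
      rw [ih k hk (hlt _ (by omega)), iteratedDeriv_hciz μ _ (hlt _ (by omega)),
        show n + 1 = (k + 1) + (n - k) by omega, pow_add]
      ring
    rw [Finset.sum_congr rfl h3, add_right_inj, Nat.sub_self,
      iteratedDeriv_hciz μ 0 (hlt 0 (Nat.zero_le _)), hI0] at h1
    simpa using h1.symm

section CycleTraces

variable {α : Type} [Fintype α] [DecidableEq α]

lemma isCycle_of_sameCycle [Nontrivial α] {σ : Equiv.Perm α} (h : ∀ a b, σ.SameCycle a b) :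
    σ.IsCycle ∧ σ.support = Finset.univ := by
  have h1 : ∀ a, σ a ≠ a := by
    intro a ha
    obtain ⟨b, hb⟩ := exists_ne a
    obtain ⟨k, hk⟩ := h a b
    exact hb (by rw [← hk, Equiv.Perm.zpow_apply_eq_self_of_apply_eq_self ha])
  obtain ⟨a⟩ := Nontrivial.to_nonempty (α := α)
  exact ⟨⟨a, h1 a, fun b _ => h a b⟩, by ext; simp [h1]⟩

omit [Fintype α] [DecidableEq α] in
lemma sameCycle_permCongr {β : Type} (e : α ≃ β) {σ : Equiv.Perm α}
    (h : ∀ a b, σ.SameCycle a b) (a b : β) : (e.permCongr σ).SameCycle a b := by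
  obtain ⟨k, hk⟩ := h (e.symm a) (e.symm b)
  refine ⟨k, ?_⟩
  have : (e.permCongr σ) ^ k = e.permCongr (σ ^ k) := (map_zpow (Equiv.permCongrHom e) σ k).symm
  rw [this]
  simp [hk]

lemma parts_partition_subtypeCongr (p : α → Prop) [DecidablePred p]
    (σ : Equiv.Perm {a // p a}) (τ : Equiv.Perm {a // ¬ p a}) :
    (σ.subtypeCongr τ).partition.parts = σ.partition.parts + τ.partition.parts := by
  have h : σ.subtypeCongr τ = Equiv.Perm.ofSubtype σ * Equiv.Perm.ofSubtype τ := by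
    ext a
    by_cases ha : p a
    · have h1 : Equiv.Perm.ofSubtype τ a = a :=
        Equiv.Perm.ofSubtype_apply_of_not_mem τ (not_not.2 ha)
      simp [ha, h1, Equiv.Perm.ofSubtype_apply_of_mem σ ha]
    · rw [Equiv.Perm.subtypeCongr.right_apply _ _ ha, Equiv.Perm.mul_apply,
        Equiv.Perm.ofSubtype_apply_of_mem τ ha,
        Equiv.Perm.ofSubtype_apply_of_not_mem σ (τ ⟨a, ha⟩).2]
  have hd : Equiv.Perm.Disjoint (Equiv.Perm.ofSubtype σ) (Equiv.Perm.ofSubtype τ) := by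
    intro a
    by_cases ha : p a
    · exact Or.inr (Equiv.Perm.ofSubtype_apply_of_not_mem τ (not_not.2 ha))
    · exact Or.inl (Equiv.Perm.ofSubtype_apply_of_not_mem σ ha)
  have hc := Fintype.card_subtype_compl p
  have h1 := Fintype.card_subtype_le p
  have h2 := Finset.card_le_univ σ.support
  have h3 := Finset.card_le_univ τ.support
  simp only [Equiv.Perm.parts_partition]
  rw [h, hd.cycleType_mul, hd.card_support_mul, Equiv.Perm.cycleType_ofSubtype,
    Equiv.Perm.cycleType_ofSubtype, Equiv.Perm.support_ofSubtype, Equiv.Perm.support_ofSubtype,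
    Finset.card_map, Finset.card_map, add_add_add_comm, ← Multiset.replicate_add]
  congr 2
  omega

lemma trace_pow_finRotate {m : Type} [Fintype m] [DecidableEq m] (A : Matrix m m ℂ) {n : ℕ} :
    permSum (fun _ => A) (finRotate (n + 1)) = (A ^ (n + 1)).trace := by
  have key : ∀ (n : ℕ) (M : Fin (n + 1) → Matrix m m ℂ) (k : ℕ), M 0 = A ^ k →
      (∀ a : Fin n, M a.succ = A) → permSum M (finRotate (n + 1)) = (A ^ (k + n)).trace := by
    intro n
    induction n with
    | zero =>
      intro M k h0 _
      have h : finRotate 1 = Equiv.Perm.decomposeFin.symm (0, 1) := Subsingleton.elim _ _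
      rw [h, permSum_decomposeFin_zero, h0]
      simp [permSum]
    | succ n ih =>
      intro M k h0 h1
      rw [finRotate_succ_eq_decomposeFin, show (1 : Fin (n + 2)) = Fin.succ 0 from rfl,
        permSum_decomposeFin_succ, ih _ (k + 1), add_right_comm, add_assoc]
      · rw [Function.update_self, h0, h1, pow_succ]
      · intro a
        rw [Function.update_of_ne (Fin.succ_ne_zero a), h1]
  rw [key n _ 1 (pow_one A).symm fun _ => rfl, add_comm]

lemma permSum_of_sameCycle {m : Type} [Fintype m] [DecidableEq m] (A : Matrix m m ℂ)
    [Nonempty α] {σ : Equiv.Perm α} (h : ∀ a b, σ.SameCycle a b) :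
    permSum (fun _ => A) σ = (A ^ Fintype.card α).trace ∧
      σ.partition.parts = {Fintype.card α} := by
  obtain ⟨n, hn⟩ := Nat.exists_eq_succ_of_ne_zero (Fintype.card_ne_zero (α := α))
  have e : α ≃ Fin (n + 1) := Fintype.equivFinOfCardEq hn
  have h1 : permSum (fun _ => A) σ = permSum (fun _ => A) (e.permCongr σ) :=
    (permSum_reindex e (fun _ => A) _).symm
  rw [h1, Equiv.Perm.parts_partition, hn]
  have h2 := sameCycle_permCongr e h
  rcases Nat.eq_zero_or_pos n with rfl | hpos
  · have hs : Subsingleton (Fin (0 + 1)) := inferInstanceAs (Subsingleton (Fin 1))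
    have h3 : σ = 1 := by
      have := e.subsingleton
      exact Subsingleton.elim _ _
    rw [Subsingleton.elim (e.permCongr σ) (finRotate (0 + 1)), trace_pow_finRotate, h3]
    simp
  · obtain ⟨n, rfl⟩ := Nat.exists_eq_succ_of_ne_zero hpos.ne'
    have h3 := isCycle_of_sameCycle h2
    have h4 : (e.permCongr σ).cycleType = (finRotate (n + 2)).cycleType := by
      rw [cycleType_finRotate, h3.1.cycleType, h3.2, Finset.card_univ, Fintype.card_fin]
    obtain ⟨c, hc⟩ := isConj_iff.1 (Equiv.Perm.isConj_of_cycleType_eq h4)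
    have : Nontrivial α := e.nontrivial
    have h5 := isCycle_of_sameCycle h
    refine ⟨?_, ?_⟩
    · rw [← trace_pow_finRotate, ← hc, ← Equiv.permCongr_eq_mul]
      exact (permSum_reindex c (fun _ => A) _).symm
    · rw [h5.1.cycleType, h5.2, Finset.card_univ, hn]
      simp

lemma permSum_eq_prod {m : Type} [Fintype m] [DecidableEq m] (A : Matrix m m ℂ)
    (σ : Equiv.Perm α) :
    permSum (fun _ => A) σ = (σ.partition.parts.map fun k => (A ^ k).trace).prod := by
  obtain ⟨n, hn⟩ : ∃ n, Fintype.card α = n := ⟨_, rfl⟩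
  induction n using Nat.strong_induction_on generalizing α with
  | _ n ih =>
    rcases isEmpty_or_nonempty α with hα | ⟨⟨x⟩⟩
    · have h : σ = 1 := Subsingleton.elim _ _
      rw [Equiv.Perm.parts_partition, h]
      simp [permSum]
    · classical
      have hp : ∀ a, σ.SameCycle x (σ a) ↔ σ.SameCycle x a := fun a =>
        Equiv.Perm.sameCycle_apply_right
      have hσ : σ = (σ.subtypePerm hp).subtypeCongr (σ.subtypePerm fun a => (hp a).not) := by
        ext a
        by_cases ha : σ.SameCycle x a <;> simp [ha]
      have : Nonempty {a // σ.SameCycle x a} := ⟨⟨x, Equiv.Perm.SameCycle.refl _ _⟩⟩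
      have h1 := permSum_of_sameCycle A (σ := σ.subtypePerm hp) fun a b =>
        Equiv.Perm.sameCycle_subtypePerm.2 (a.2.symm.trans b.2)
      have h2 : Fintype.card {a // ¬ σ.SameCycle x a} < n := by
        rw [← hn]
        exact Fintype.card_subtype_lt (x := x) (not_not.2 (Equiv.Perm.SameCycle.refl _ _))
      rw [hσ, permSum_subtypeCongr, parts_partition_subtypeCongr, Multiset.map_add,
        Multiset.prod_add, h1.1, h1.2, ih _ h2 _ rfl]
      simp

end CycleTraces

section RiemannHurwitz

variable {α : Type}

/-- The space of functions constant on the cycles of `σ`. -/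
def fixSub (σ : Equiv.Perm α) : Submodule (ZMod 2) (α → ZMod 2) where
  carrier := {f | ∀ a, f (σ a) = f a}
  zero_mem' := fun _ => rfl
  add_mem' := fun hf hg a => by rw [Pi.add_apply, Pi.add_apply, hf a, hg a]
  smul_mem' := fun c f hf a => by rw [Pi.smul_apply, Pi.smul_apply, hf a]

/-- The space of functions taking the same value at `a` and `b`. -/
def agreeSub (a b : α) : Submodule (ZMod 2) (α → ZMod 2) where
  carrier := {f | f a = f b}
  zero_mem' := rfl
  add_mem' := fun {f g} (hf : f a = f b) (hg : g a = g b) => by simp [hf, hg]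
  smul_mem' := fun c f (hf : f a = f b) => by simp [hf]

/-- The space of functions constant on the orbits of `σ` and the transpositions in `L`. -/
def connSub (σ : Equiv.Perm α) (L : List (α × α)) : Submodule (ZMod 2) (α → ZMod 2) where
  carrier := {f | (∀ a, f (σ a) = f a) ∧ ∀ q ∈ L, f q.1 = f q.2}
  zero_mem' := ⟨fun _ => rfl, fun _ _ => rfl⟩
  add_mem' := fun hf hg => ⟨fun a => by rw [Pi.add_apply, Pi.add_apply, hf.1 a, hg.1 a],
    fun q hq => by rw [Pi.add_apply, Pi.add_apply, hf.2 q hq, hg.2 q hq]⟩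
  smul_mem' := fun c f hf => ⟨fun a => by rw [Pi.smul_apply, Pi.smul_apply, hf.1 a],
    fun q hq => by rw [Pi.smul_apply, Pi.smul_apply, hf.2 q hq]⟩

lemma connSub_append (σ : Equiv.Perm α) (L : List (α × α)) (q : α × α) :
    connSub σ (L ++ [q]) = connSub σ L ⊓ agreeSub q.1 q.2 := by
  ext f
  simp only [connSub, agreeSub, Submodule.mem_inf, Submodule.mem_mk, AddSubmonoid.mem_mk,
    AddSubsemigroup.mem_mk, Set.mem_ofPred_eq, List.forall_mem_append, List.forall_mem_singleton,
    and_assoc]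

variable [DecidableEq α]

lemma fixSub_mul_swap_inf (π : Equiv.Perm α) (a b : α) :
    fixSub (π * Equiv.swap a b) ⊓ agreeSub a b = fixSub π ⊓ agreeSub a b := by
  have h : ∀ f : α → ZMod 2, f a = f b → ∀ x, f (Equiv.swap a b x) = f x := by
    intro f hf x
    rw [Equiv.swap_apply_def]
    split_ifs with h1 h2
    · rw [h1, hf]
    · rw [h2, hf]
    · rfl
  ext f
  refine and_congr_left fun (hf : f a = f b) => ⟨fun h1 x => ?_, fun h1 x => ?_⟩
  · have := h1 (Equiv.swap a b x)
    rwa [Equiv.Perm.mul_apply, Equiv.swap_apply_self, h f hf] at this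
  · rw [Equiv.Perm.mul_apply, h1, h f hf]

lemma connSub_le_fixSub (σ : Equiv.Perm α) (L : List (α × α)) :
    connSub σ L ≤ fixSub (σ * swapProd L) := by
  induction L using List.reverseRecOn with
  | nil =>
    rw [show σ * swapProd [] = σ from mul_one σ]
    exact fun f hf => hf.1
  | append_singleton L q ih =>
    rw [connSub_append, swapProd_append, ← mul_assoc]
    refine le_trans ?_ (inf_le_left (b := agreeSub q.1 q.2))
    rw [fixSub_mul_swap_inf]
    exact inf_le_inf_right _ ih

variable [Fintype α]

lemma fixSub_mul_swap_le (π : Equiv.Perm α) {a b : α} {f : α → ZMod 2} (hf : f ∈ fixSub π)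
    (hab : f a ≠ f b) : fixSub (π * Equiv.swap a b) ≤ agreeSub a b := by
  intro g hg
  let S := Finset.univ.filter fun x => f x = f a
  have ha : a ∈ S := by simp [S]
  have hb : b ∉ S := by simpa [S] using hab.symm
  have h1 : ∀ y, g (π y) = g (Equiv.swap a b y) := fun y => by
    have := hg (Equiv.swap a b y)
    rwa [Equiv.Perm.mul_apply, Equiv.swap_apply_self] at this
  have h2 : ∑ y ∈ S, g (π y) = ∑ y ∈ S, g y := by
    refine Finset.sum_equiv π (fun y => ?_) fun y _ => rfl
    simp only [S, Finset.mem_filter, Finset.mem_univ, true_and]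
    rw [hf y]
  rw [← Finset.add_sum_erase _ _ ha, ← Finset.add_sum_erase _ g ha, h1, Equiv.swap_apply_left,
    Finset.sum_congr rfl (g := g), add_left_inj] at h2
  · exact h2.symm
  · intro y hy
    have hy' := Finset.mem_erase.1 hy
    rw [h1, Equiv.swap_apply_of_ne_of_ne hy'.1 fun h => hb (by rw [← h]; exact hy'.2)]

omit [DecidableEq α] in
lemma finrank_le_inf_agreeSub (S : Submodule (ZMod 2) (α → ZMod 2)) (a b : α) :
    Module.finrank (ZMod 2) S ≤ Module.finrank (ZMod 2) ↥(S ⊓ agreeSub a b) + 1 := by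
  let φ : S →ₗ[ZMod 2] ZMod 2 :=
    (LinearMap.proj (R := ZMod 2) (φ := fun _ : α => ZMod 2) a - LinearMap.proj b).comp S.subtype
  have h1 := φ.finrank_range_add_finrank_ker
  have h2 : Module.finrank (ZMod 2) (LinearMap.range φ) ≤ 1 :=
    (Submodule.finrank_le _).trans_eq (Module.finrank_self _)
  have h3 : Module.finrank (ZMod 2) (LinearMap.ker φ) ≤
      Module.finrank (ZMod 2) ↥(S ⊓ agreeSub a b) := by
    rw [← Submodule.finrank_map_subtype_eq]
    refine Submodule.finrank_mono ?_
    rintro _ ⟨f, hf, rfl⟩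
    exact ⟨f.2, sub_eq_zero.1 (LinearMap.mem_ker.1 hf)⟩
  omega

lemma finrank_fixSub_add_le (σ : Equiv.Perm α) (L : List (α × α)) :
    Module.finrank (ZMod 2) (fixSub σ) + Module.finrank (ZMod 2) (fixSub (σ * swapProd L)) ≤
      L.length + 2 * Module.finrank (ZMod 2) (connSub σ L) := by
  induction L using List.reverseRecOn with
  | nil =>
    have h : connSub σ [] = fixSub σ := by ext f; simp [connSub, fixSub]
    rw [h, show σ * swapProd [] = σ from mul_one σ, two_mul]
    exact le_add_self
  | append_singleton L q ih =>
    rw [connSub_append, swapProd_append, ← mul_assoc, List.length_append, List.length_singleton]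
    set π := σ * swapProd L
    by_cases hc : connSub σ L ≤ agreeSub q.1 q.2
    · rw [inf_eq_left.2 hc]
      have h1 := finrank_le_inf_agreeSub (fixSub (π * Equiv.swap q.1 q.2)) q.1 q.2
      rw [fixSub_mul_swap_inf] at h1
      have h2 : Module.finrank (ZMod 2) ↥(fixSub π ⊓ agreeSub q.1 q.2) ≤ _ :=
        Submodule.finrank_mono (inf_le_left (a := fixSub π))
      omega
    · obtain ⟨f, hf, hf'⟩ := Set.not_subset.1 hc
      have hfπ : f ∈ fixSub π := connSub_le_fixSub σ L hf
      have h1 := fixSub_mul_swap_inf π q.1 q.2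
      rw [inf_eq_left.2 (fixSub_mul_swap_le π hfπ hf')] at h1
      have h2 : fixSub π ⊓ agreeSub q.1 q.2 < fixSub π :=
        lt_of_le_of_ne inf_le_left fun h => hf' (inf_eq_left.1 h hfπ)
      have h3 := Submodule.finrank_lt_finrank_of_lt h2
      have h4 := finrank_le_inf_agreeSub (connSub σ L) q.1 q.2
      rw [h1]
      omega

lemma finrank_fixSub (σ : Equiv.Perm α) :
    Module.finrank (ZMod 2) (fixSub σ) = σ.partition.parts.card := by
  classical
  have h1 := permSum_eq_prod (1 : Matrix (ZMod 2) (ZMod 2) ℂ) σ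
  have h2 : permSum (fun _ => (1 : Matrix (ZMod 2) (ZMod 2) ℂ)) σ = (Nat.card (fixSub σ) : ℂ) := by
    have h3 : ∀ i : α → ZMod 2, ∏ k, (1 : Matrix (ZMod 2) (ZMod 2) ℂ) (i k) (i (σ k)) =
        if i ∈ fixSub σ then 1 else 0 := by
      intro i
      simp only [Matrix.one_apply, Finset.prod_ite_zero, Finset.prod_const_one]
      refine if_congr ⟨fun h a => (h a (Finset.mem_univ a)).symm, fun h a _ => (h a).symm⟩ rfl rfl
    simp only [permSum, h3]
    rw [Finset.sum_boole, Nat.card_eq_fintype_card, Fintype.card_subtype]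
  rw [h2, Nat.card_eq_fintype_card, Module.card_eq_pow_finrank (K := ZMod 2)] at h1
  simp only [ZMod.card, one_pow, Matrix.trace_one, Multiset.map_const', Multiset.prod_replicate]
    at h1
  exact Nat.pow_right_injective le_rfl (by exact_mod_cast h1)

omit [DecidableEq α] [Fintype α] in
lemma finrank_connSub_le_one {σ : Equiv.Perm α} {L : List (α × α)} (h : IsConn σ L) :
    Module.finrank (ZMod 2) (connSub σ L) ≤ 1 := by
  refine ((Submodule.finrank_mono ?_).trans (finrank_span_le_card
    ({fun _ => 1} : Set (α → ZMod 2)))).trans ?_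
  · intro f hf
    rcases isEmpty_or_nonempty α with hα | ⟨⟨x⟩⟩
    · rw [Subsingleton.elim f 0]
      exact zero_mem _
    · have := h {a | f a = f x} ⟨fun a => by simp [hf.1 a], fun q hq => by simp [hf.2 q hq]⟩ ⟨x, rfl⟩
      refine Submodule.mem_span_singleton.2 ⟨f x, ?_⟩
      ext a
      have ha : a ∈ {a | f a = f x} := this ▸ Set.mem_univ a
      simpa using ha.symm
  · simp

lemma sign_eq_neg_one_pow_parts (σ : Equiv.Perm α) :
    Equiv.Perm.sign σ = (-1) ^ (Fintype.card α + σ.partition.parts.card) := by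
  have h1 := Finset.card_le_univ σ.support
  rw [Equiv.Perm.sign_of_cycleType, Equiv.Perm.parts_partition, Multiset.card_add,
    Multiset.card_replicate, Equiv.Perm.sum_cycleType, Int.units_pow_eq_pow_mod_two (-1),
    Int.units_pow_eq_pow_mod_two (-1) (Fintype.card α + _)]
  congr 1
  omega

lemma sign_swapProd {κ : α → ℕ} {L : List (α × α)} (hL : ∀ q ∈ L, κ q.1 < κ q.2) :
    Equiv.Perm.sign (swapProd L) = (-1) ^ L.length := by
  rw [swapProd, map_list_prod, List.map_map]
  rw [List.prod_eq_pow_card _ (-1), List.length_map]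
  intro u hu
  obtain ⟨q, hq, rfl⟩ := List.mem_map.1 hu
  exact Equiv.Perm.sign_swap fun h => (hL q hq).ne (congrArg κ h)

lemma parts_partition_inv (σ : Equiv.Perm α) : σ⁻¹.partition.parts = σ.partition.parts := by
  rw [Equiv.Perm.parts_partition, Equiv.Perm.parts_partition, Equiv.Perm.cycleType_inv,
    Equiv.Perm.support_inv]

lemma exists_genus {κ : α → ℕ} {σ : Equiv.Perm α} {L : List (α × α)} (h : IsConn σ L)
    (hL : ∀ q ∈ L, κ q.1 < κ q.2) :
    ∃ g, L.length + 2 = 2 * g + (σ * swapProd L)⁻¹.partition.parts.card +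
      σ.partition.parts.card := by
  have h1 := finrank_fixSub_add_le σ L
  have h2 := finrank_connSub_le_one h
  rw [finrank_fixSub, finrank_fixSub] at h1
  have h3 := sign_eq_neg_one_pow_parts (σ * swapProd L)
  rw [map_mul, sign_swapProd hL, sign_eq_neg_one_pow_parts, ← pow_add, Int.units_pow_eq_pow_mod_two (-1),
    Int.units_pow_eq_pow_mod_two (-1) (Fintype.card α + (σ * swapProd L).partition.parts.card)] at h3
  have h4 : (Fintype.card α + σ.partition.parts.card + L.length) % 2 =
      (Fintype.card α + (σ * swapProd L).partition.parts.card) % 2 := by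
    have h5 : (1 : ℤˣ) ≠ -1 := by decide
    rcases Nat.mod_two_eq_zero_or_one
      (Fintype.card α + σ.partition.parts.card + L.length) with h | h <;>
    rcases Nat.mod_two_eq_zero_or_one
      (Fintype.card α + (σ * swapProd L).partition.parts.card) with h' | h' <;>
    simp_all
  rw [parts_partition_inv]
  exact ⟨(L.length + 2 - (σ * swapProd L).partition.parts.card - σ.partition.parts.card) / 2,
    by omega⟩

end RiemannHurwitz

section Limits

/-- The sequence `u` converges to `c` with an error of smaller order than `N ^ (-2 h)`. -/
def ConvergesFast (h : ℕ) (u : ℕ → ℂ) (c : ℂ) : Prop :=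
  Filter.Tendsto (fun N : ℕ => (N : ℂ) ^ (2 * h) * (u N - c)) Filter.atTop (nhds 0)

lemma tendsto_inv_natCast_pow_mul (k : ℕ) {f : ℕ → ℂ}
    (hf : Filter.Tendsto f Filter.atTop (nhds 0)) :
    Filter.Tendsto (fun N : ℕ => ((N : ℂ) ^ k)⁻¹ * f N) Filter.atTop (nhds 0) := by
  refine squeeze_zero_norm' ?_ (tendsto_zero_iff_norm_tendsto_zero.1 hf)
  filter_upwards [Filter.eventually_ge_atTop 1] with N hN
  have h1 : (1 : ℝ) ≤ (N : ℝ) ^ k := one_le_pow₀ (by exact_mod_cast hN)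
  rw [norm_mul, norm_inv, norm_pow, Complex.norm_natCast]
  exact mul_le_of_le_one_left (norm_nonneg _) (inv_le_one_of_one_le₀ h1)

variable {h : ℕ} {u v : ℕ → ℂ} {a b : ℂ}

lemma ConvergesFast.tendsto (hu : ConvergesFast h u a) :
    Filter.Tendsto u Filter.atTop (nhds a) := by
  rw [← tendsto_sub_nhds_zero_iff]
  refine (tendsto_inv_natCast_pow_mul (2 * h) hu).congr' ?_
  filter_upwards [Filter.eventually_ge_atTop 1] with N hN
  have : (N : ℂ) ≠ 0 := by exact_mod_cast (by omega : N ≠ 0)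
  rw [inv_mul_cancel_left₀ (pow_ne_zero _ this)]

lemma ConvergesFast.mul (hu : ConvergesFast h u a) (hv : ConvergesFast h v b) :
    ConvergesFast h (fun N => u N * v N) (a * b) := by
  have h1 := (Filter.Tendsto.mul hu hv.tendsto).add (Filter.Tendsto.const_mul a hv)
  simp only [zero_mul, mul_zero, add_zero] at h1
  refine h1.congr fun N => ?_
  ring

lemma convergesFast_const (h : ℕ) (a : ℂ) : ConvergesFast h (fun _ => a) a := by
  simp [ConvergesFast]

lemma ConvergesFast.multiset_prod {u : ℕ → ℕ → ℂ} {a : ℕ → ℂ} (s : Multiset ℕ)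
    (hs : ∀ k ∈ s, ConvergesFast h (fun N => u N k) (a k)) :
    ConvergesFast h (fun N => (s.map (u N)).prod) (s.map a).prod := by
  induction s using Multiset.induction_on with
  | empty => simpa using convergesFast_const h 1
  | cons k s ih =>
    simp only [Multiset.map_cons, Multiset.prod_cons]
    exact (hs k (Multiset.mem_cons_self k s)).mul
      (ih fun j hj => hs j (Multiset.mem_cons_of_mem hj))

lemma tendsto_tsum_of_convergesFast {ι P : Type} [Finite P] (h : ℕ) (π : ι → P) (g : ι → ℕ)
    (U : ℕ → P → ℂ) (V : P → ℂ) (hU : ∀ p, ConvergesFast h (fun N => U N p) (V p))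
    {m : ℕ} (hm : 1 ≤ m) (hs : Summable fun c => ((m : ℝ) ^ (2 * g c))⁻¹) :
    Filter.Tendsto (fun N : ℕ => ∑' c, (N : ℂ) ^ (2 * h) * (U N (π c) / (N : ℂ) ^ (2 * g c) -
      if g c < h + 1 then V (π c) / (N : ℂ) ^ (2 * g c) else 0)) Filter.atTop (nhds 0) := by
  obtain ⟨K, hK⟩ := (Set.finite_range fun p => ‖V p‖).bddAbove
  have hV : ∀ p, ‖V p‖ ≤ K := fun p => hK ⟨p, rfl⟩
  have h1 : ∀ᶠ N : ℕ in Filter.atTop, ∀ p, ‖(N : ℂ) ^ (2 * h) * (U N p - V p)‖ < 1 :=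
    Filter.eventually_all.2 fun p =>
      (tendsto_zero_iff_norm_tendsto_zero.1 (hU p)).eventually_lt_const one_pos
  have h2 : ∀ᶠ N : ℕ in Filter.atTop, ∀ p, ‖U N p‖ < K + 1 :=
    Filter.eventually_all.2 fun p =>
      (hU p).tendsto.norm.eventually_lt_const ((hV p).trans_lt (lt_add_one K))
  have hge : ∀ (N : ℕ) (c : ι), h + 1 ≤ g c → 1 ≤ N →
      (N : ℂ) ^ (2 * h) * (U N (π c) / (N : ℂ) ^ (2 * g c) -
        if g c < h + 1 then V (π c) / (N : ℂ) ^ (2 * g c) else 0) =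
      ((N : ℂ) ^ (2 * (g c - h)))⁻¹ * U N (π c) := by
    intro N c hc hN
    have hN' : (N : ℂ) ≠ 0 := by exact_mod_cast (by omega : N ≠ 0)
    obtain ⟨k, hk⟩ := Nat.exists_eq_add_of_le (by omega : h ≤ g c)
    rw [if_neg (by omega), hk, Nat.add_sub_cancel_left, mul_add, pow_add]
    field_simp
    simp
  have hlt : ∀ (N : ℕ) (c : ι), g c < h + 1 →
      (N : ℂ) ^ (2 * h) * (U N (π c) / (N : ℂ) ^ (2 * g c) -
        if g c < h + 1 then V (π c) / (N : ℂ) ^ (2 * g c) else 0) =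
      ((N : ℂ) ^ (2 * g c))⁻¹ * ((N : ℂ) ^ (2 * h) * (U N (π c) - V (π c))) := by
    intro N c hc
    rw [if_pos hc]
    ring
  have key := tendsto_tsum_of_dominated_convergence (𝓕 := Filter.atTop)
    (f := fun (N : ℕ) c => (N : ℂ) ^ (2 * h) * (U N (π c) / (N : ℂ) ^ (2 * g c) -
      if g c < h + 1 then V (π c) / (N : ℂ) ^ (2 * g c) else 0)) (g := fun _ => 0)
    (bound := fun c => (1 + (m : ℝ) ^ (2 * h) * (|K| + 1)) * ((m : ℝ) ^ (2 * g c))⁻¹)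
    (hs.mul_left _) ?_ ?_
  · simpa using key
  · intro c
    rcases Nat.lt_or_ge (g c) (h + 1) with hc | hc
    · exact (tendsto_inv_natCast_pow_mul (2 * g c) (hU (π c))).congr fun N => (hlt N c hc).symm
    · have h3 : Filter.Tendsto (fun N : ℕ => ((N : ℂ) ^ (2 * (g c - h)))⁻¹) Filter.atTop
          (nhds 0) := by
        refine (Filter.Tendsto.congr (fun N => inv_pow _ _)
          (tendsto_inv_atTop_nhds_zero_nat (𝕜 := ℂ) |>.pow _)).trans ?_
        rw [zero_pow (by omega)]
      have h4 := h3.mul (hU (π c)).tendsto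
      rw [zero_mul] at h4
      refine h4.congr' ?_
      filter_upwards [Filter.eventually_ge_atTop 1] with N hN
      exact (hge N c hc hN).symm
  · filter_upwards [h1, h2, Filter.eventually_ge_atTop m] with N h1 h2 hN c
    have hm0 : (1 : ℝ) ≤ m := by exact_mod_cast hm
    have hmN : (m : ℝ) ≤ N := by exact_mod_cast hN
    have hinv : ∀ k, ((N : ℝ) ^ k)⁻¹ ≤ ((m : ℝ) ^ k)⁻¹ := fun k =>
      inv_anti₀ (by positivity) (pow_le_pow_left₀ (by positivity) hmN k)
    rcases Nat.lt_or_ge (g c) (h + 1) with hc | hc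
    · rw [hlt N c hc, norm_mul, norm_inv, norm_pow, Complex.norm_natCast]
      calc _ ≤ ((N : ℝ) ^ (2 * g c))⁻¹ * 1 := by gcongr; exact (h1 _).le
        _ ≤ ((m : ℝ) ^ (2 * g c))⁻¹ := by rw [mul_one]; exact hinv _
        _ ≤ _ := le_mul_of_one_le_left (by positivity) (le_add_of_nonneg_right (by positivity))
    · rw [hge N c hc (hm.trans hN), norm_mul, norm_inv, norm_pow, Complex.norm_natCast]
      calc _ ≤ ((m : ℝ) ^ (2 * (g c - h)))⁻¹ * (|K| + 1) := by
            gcongr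
            · exact (h2 _).le.trans (by gcongr; exact le_abs_self K)
        _ = (m : ℝ) ^ (2 * h) * (|K| + 1) * ((m : ℝ) ^ (2 * g c))⁻¹ := by
            obtain ⟨k, hk⟩ := Nat.exists_eq_add_of_le (by omega : h ≤ g c)
            rw [hk, Nat.add_sub_cancel_left, mul_add 2 h k, pow_add]
            field_simp
        _ ≤ _ := by
            gcongr
            exact le_add_of_nonneg_left zero_le_one

end Limits

section Hurwitz

variable {d : ℕ}

/-- The permutation `ρ` for which `ρ * σ * swapProd L` is the identity. -/
def closing (σ : Equiv.Perm (Fin d)) (L : List (Fin d × Fin d)) : Equiv.Perm (Fin d) :=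
  (σ * swapProd L)⁻¹

lemma swapProd_ofFn {r : ℕ} (v : Fin r → Fin d × Fin d) :
    swapProd (List.ofFn v) = (List.ofFn fun i => Equiv.swap (v i).1 (v i).2).prod := by
  rw [swapProd, List.map_ofFn]
  rfl

lemma swapProd_mem {L : List (Fin d × Fin d)} {G : Subgroup (Equiv.Perm (Fin d))}
    (h : ∀ q ∈ L, Equiv.swap q.1 q.2 ∈ G) : swapProd L ∈ G := by
  refine Subgroup.list_prod_mem _ fun τ hτ => ?_
  obtain ⟨q, hq, rfl⟩ := List.mem_map.1 hτ
  exact h q hq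

lemma apply_mem_iff_of_mem_closure {s : Set (Equiv.Perm (Fin d))} {S : Set (Fin d)}
    (hs : ∀ g ∈ s, ∀ a, g a ∈ S ↔ a ∈ S) {g : Equiv.Perm (Fin d)}
    (hg : g ∈ Subgroup.closure s) (a : Fin d) : g a ∈ S ↔ a ∈ S := by
  induction hg using Subgroup.closure_induction generalizing a with
  | mem g hg => exact hs g hg a
  | one => rfl
  | mul x y _ _ hx hy => rw [Equiv.Perm.mul_apply, hx, hy]
  | inv x _ hx => rw [← hx (x⁻¹ a), ← Equiv.Perm.mul_apply, mul_inv_cancel, Equiv.Perm.one_apply]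

lemma isConn_iff_generatesTransitively (σ : Equiv.Perm (Fin d)) {r : ℕ}
    (v : Fin r → Fin d × Fin d) : IsConn σ (List.ofFn v) ↔
      GeneratesTransitively ({closing σ (List.ofFn v), σ} ∪
        Set.range fun i => Equiv.swap (v i).1 (v i).2) := by
  have hmem : ∀ q, q ∈ List.ofFn v ↔ ∃ i, v i = q := fun q => by
    rw [List.mem_ofFn]
  constructor
  · intro h x y
    set G := Subgroup.closure ({closing σ (List.ofFn v), σ} ∪
        Set.range fun i => Equiv.swap (v i).1 (v i).2)
    have hG : ∀ g ∈ G, ∀ a, (∃ k ∈ G, k x = g a) ↔ ∃ k ∈ G, k x = a := by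
      intro g hg a
      refine ⟨fun ⟨k, hk, e⟩ => ⟨g⁻¹ * k, mul_mem (inv_mem hg) hk, ?_⟩,
        fun ⟨k, hk, e⟩ => ⟨g * k, mul_mem hg hk, ?_⟩⟩
      · rw [Equiv.Perm.mul_apply, e, ← Equiv.Perm.mul_apply, inv_mul_cancel, Equiv.Perm.one_apply]
      · rw [Equiv.Perm.mul_apply, e]
    have h1 := h {y | ∃ g ∈ G, g x = y} ⟨hG σ (Subgroup.subset_closure (by simp)), ?_⟩
      ⟨x, 1, one_mem _, rfl⟩
    · exact (h1 ▸ Set.mem_univ y : y ∈ {y | ∃ g ∈ G, g x = y})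
    · intro q hq
      obtain ⟨i, rfl⟩ := (hmem q).1 hq
      have := hG (Equiv.swap (v i).1 (v i).2) (Subgroup.subset_closure (Or.inr ⟨i, rfl⟩)) (v i).2
      rwa [Equiv.swap_apply_right] at this
  · rintro h S ⟨hσ, hL⟩ ⟨x, hx⟩
    have hswap : ∀ q ∈ List.ofFn v, ∀ a, Equiv.swap q.1 q.2 a ∈ S ↔ a ∈ S := by
      intro q hq a
      rw [Equiv.swap_apply_def]
      split_ifs with h1 h2
      · rw [h1, hL q hq]
      · rw [h2, hL q hq]
      · rfl
    have hcl : closing σ (List.ofFn v) ∈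
        Subgroup.closure ({g | ∀ a, g a ∈ S ↔ a ∈ S} : Set (Equiv.Perm (Fin d))) :=
      inv_mem (mul_mem (Subgroup.subset_closure hσ)
        (swapProd_mem fun q hq => Subgroup.subset_closure (hswap q hq)))
    refine Set.eq_univ_of_forall fun y => ?_
    obtain ⟨g, hg, rfl⟩ := h x y
    refine (apply_mem_iff_of_mem_closure ?_ hg x).2 hx
    rintro g ((rfl | rfl) | ⟨i, rfl⟩)
    · exact apply_mem_iff_of_mem_closure (fun g hg => hg) hcl
    · exact hσ
    · exact hswap _ ((hmem _).2 ⟨i, rfl⟩)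

lemma max_support_swap {s t : Fin d} (h : s < t) : (Equiv.swap s t).support.max = t := by
  rw [Equiv.Perm.support_swap h.ne, Finset.max_insert, Finset.max_singleton]
  exact max_eq_right (by exact_mod_cast h.le)

lemma swap_injective_of_lt {p q : Fin d × Fin d} (hp : p.1 < p.2) (hq : q.1 < q.2)
    (h : Equiv.swap p.1 p.2 = Equiv.swap q.1 q.2) : p = q := by
  have h2 : p.2 = q.2 := by
    have := max_support_swap hp
    rw [h, max_support_swap hq] at this
    exact (WithBot.coe_injective this).symm
  have h1 := congrArg (fun g => g p.2) h
  simp only [Equiv.swap_apply_right] at h1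
  rw [h2, Equiv.swap_apply_right] at h1
  exact Prod.ext h1 h2

lemma exists_lt_swap {τ : Equiv.Perm (Fin d)} (h : τ.IsSwap) :
    ∃ q : Fin d × Fin d, q.1 < q.2 ∧ Equiv.swap q.1 q.2 = τ := by
  obtain ⟨a, b, hab, rfl⟩ := h
  rcases hab.lt_or_gt with h | h
  · exact ⟨(a, b), h, rfl⟩
  · exact ⟨(b, a), h, Equiv.swap_comm _ _⟩

/-- The transitive pairs of a permutation of `Fin d` and a monotone word. -/
abbrev ConnPair (d : ℕ) : Type :=
  {q : Equiv.Perm (Fin d) × Word (Fin.val : Fin d → ℕ) // IsConn q.1 q.2.1}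

lemma isWord_ofFn {r : ℕ} (v : Fin r → Fin d × Fin d) :
    IsWord Fin.val (List.ofFn v) ↔
      (∀ i, (v i).1 < (v i).2) ∧ Monotone fun i => (v i).2 := by
  unfold IsWord
  rw [List.forall_mem_ofFn_iff, List.pairwise_ofFn, monotone_iff_forall_lt]
  rfl

lemma isMonotoneTuple_iff {r : ℕ} {v : Fin r → Fin d × Fin d} (hv : ∀ i, (v i).1 < (v i).2) :
    IsMonotoneTuple (fun i => Equiv.swap (v i).1 (v i).2) ↔ Monotone fun i => (v i).2 := by
  unfold IsMonotoneTuple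
  simp only [max_support_swap (hv _)]
  refine ⟨fun h i j hij => WithBot.coe_le_coe.1 (h.2 hij),
    fun h => ⟨fun i => ⟨_, _, (hv i).ne, rfl⟩, fun i j hij => WithBot.coe_le_coe.2 (h hij)⟩⟩

/-- The tuples of increasing pairs encoding the factorizations counted by `Hr`. -/
abbrev ConnTuple (d r : ℕ) (α β : d.Partition) : Type :=
  {s : Equiv.Perm (Fin d) × (Fin r → Fin d × Fin d) //
    (IsWord Fin.val (List.ofFn s.2) ∧ IsConn s.1 (List.ofFn s.2)) ∧
      HasCycleType (closing s.1 (List.ofFn s.2)) α ∧ HasCycleType s.1 β}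

lemma hr_eq_card_connTuple (r : ℕ) (α β : d.Partition) :
    Hr d α β r = Nat.card (ConnTuple d r α β) := by
  symm
  let f : ConnTuple d r α β → {T : Equiv.Perm (Fin d) × Equiv.Perm (Fin d) ×
      (Fin r → Equiv.Perm (Fin d)) //
      HasCycleType T.1 α ∧ HasCycleType T.2.1 β ∧ IsMonotoneTuple T.2.2 ∧
      T.1 * T.2.1 * (List.ofFn T.2.2).prod = 1 ∧
      GeneratesTransitively ({T.1, T.2.1} ∪ Set.range T.2.2)} := fun s =>
    ⟨(closing s.1.1 (List.ofFn s.1.2), s.1.1, fun i => Equiv.swap (s.1.2 i).1 (s.1.2 i).2),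
      s.2.2.1, s.2.2.2, (isMonotoneTuple_iff ((isWord_ofFn _).1 s.2.1.1).1).2
        ((isWord_ofFn _).1 s.2.1.1).2,
      by rw [← swapProd_ofFn, mul_assoc]; exact inv_mul_cancel _,
      (isConn_iff_generatesTransitively _ _).1 s.2.1.2⟩
  refine Nat.card_eq_of_bijective f ⟨?_, ?_⟩
  · rintro ⟨⟨σ, v⟩, hs⟩ ⟨⟨σ', v'⟩, hs'⟩ h
    simp only [f, Subtype.mk.injEq, Prod.mk.injEq] at h
    refine Subtype.ext (Prod.ext h.2.1 (funext fun i => ?_))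
    exact swap_injective_of_lt (((isWord_ofFn v).1 hs.1.1).1 i) (((isWord_ofFn v').1 hs'.1.1).1 i)
      (congrFun h.2.2 i)
  · rintro ⟨⟨ρ, σ, τ⟩, h1, h2, h3, h4, h5⟩
    choose v hv hτ using fun i => exists_lt_swap (h3.1 i)
    obtain rfl : (fun i => Equiv.swap (v i).1 (v i).2) = τ := funext hτ
    have h6 : closing σ (List.ofFn v) = ρ := by
      rw [closing, swapProd_ofFn]
      refine (eq_inv_of_mul_eq_one_left ?_).symm
      rw [← mul_assoc]
      exact h4
    subst h6
    refine ⟨⟨(σ, v), ⟨(isWord_ofFn v).2 ⟨hv, (isMonotoneTuple_iff hv).1 h3⟩,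
      (isConn_iff_generatesTransitively _ _).2 h5⟩, h1, h2⟩, rfl⟩

lemma card_connTuple (r : ℕ) (α β : d.Partition) :
    Nat.card (ConnTuple d r α β) = Nat.card {q : ConnPair d // q.1.2.1.length = r ∧
      HasCycleType (closing q.1.1 q.1.2.1) α ∧ HasCycleType q.1.1 β} := by
  let f : ConnTuple d r α β → {q : ConnPair d // q.1.2.1.length = r ∧
      HasCycleType (closing q.1.1 q.1.2.1) α ∧ HasCycleType q.1.1 β} := fun s =>
    ⟨⟨(s.1.1, ⟨List.ofFn s.1.2, s.2.1.1⟩), s.2.1.2⟩, List.length_ofFn, s.2.2⟩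
  refine Nat.card_eq_of_bijective f ⟨?_, ?_⟩
  · rintro ⟨⟨σ, v⟩, hs⟩ ⟨⟨σ', v'⟩, hs'⟩ h
    simp only [f, Subtype.mk.injEq, Prod.mk.injEq] at h
    exact Subtype.ext (Prod.ext h.1 (List.ofFn_injective h.2))
  · rintro ⟨⟨⟨σ, ⟨L, hL⟩⟩, hc⟩, rfl, h1, h2⟩
    dsimp only at hc h1 h2
    refine ⟨⟨(σ, L.get), ?_⟩, ?_⟩
    · rw [List.ofFn_get]
      exact ⟨⟨hL, hc⟩, h1, h2⟩
    · simp [f]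

end Hurwitz

section Genus

variable {d : ℕ}

/-- The cycle type of a permutation of `Fin d` as a partition of `d`. -/
def cyclePartition (σ : Equiv.Perm (Fin d)) : d.Partition :=
  ⟨σ.partition.parts, fun h => σ.partition.parts_pos h, by
    rw [σ.partition.parts_sum, Fintype.card_fin]⟩

lemma hasCycleType_iff (σ : Equiv.Perm (Fin d)) (α : d.Partition) :
    HasCycleType σ α ↔ α = cyclePartition σ := by
  rw [HasCycleType, Nat.Partition.ext_iff]
  exact eq_comm

/-- The cycle types of the two permutations of a factorization. -/
def ConnPair.types (q : ConnPair d) : d.Partition × d.Partition :=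
  (cyclePartition (closing q.1.1 q.1.2.1), cyclePartition q.1.1)

lemma ConnPair.exists_genus (q : ConnPair d) : ∃ g, q.1.2.1.length + 2 =
    2 * g + q.types.1.parts.card + q.types.2.parts.card :=
  HCIZ.exists_genus q.2 q.1.2.2.1

/-- The genus of a transitive factorization. -/
noncomputable def ConnPair.genus (q : ConnPair d) : ℕ := q.exists_genus.choose

lemma ConnPair.genus_spec (q : ConnPair d) : q.1.2.1.length + 2 =
    2 * q.genus + q.types.1.parts.card + q.types.2.parts.card :=
  q.exists_genus.choose_spec

lemma card_parts_le (α : d.Partition) : α.parts.card ≤ d := by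
  have h := Multiset.card_nsmul_le_sum (s := α.parts) (a := 1) fun i hi => α.parts_pos hi
  rw [α.parts_sum] at h
  simpa using h

lemma card_parts_pos (hd : 1 ≤ d) (α : d.Partition) : 1 ≤ α.parts.card := by
  refine Nat.one_le_iff_ne_zero.2 fun h => ?_
  have := α.parts_sum
  rw [Multiset.card_eq_zero.1 h] at this
  simp at this
  omega

/-- The contribution of a pair of cycle types to `Cseq`. -/
noncomputable def typeWeight (Φ Ψ : ℕ → ℂ) (p : d.Partition × d.Partition) : ℂ :=
  (-1) ^ (d + p.1.parts.card + p.2.parts.card) * momProd Φ p.1 * momProd Ψ p.2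

lemma finite_connPair_length_le (r : ℕ) : {q : ConnPair d | q.1.2.1.length ≤ r}.Finite := by
  have h1 : {L : List (Fin d × Fin d) | L.length ≤ r}.Finite := List.finite_length_le _ r
  refine Set.Finite.of_finite_image (f := fun q : ConnPair d => (q.1.1, q.1.2.1))
    ((Set.finite_univ.prod h1).subset ?_) ?_
  · rintro _ ⟨q, hq, rfl⟩
    exact ⟨Set.mem_univ _, hq⟩
  · intro q _ q' _ h
    have h2 := Prod.mk.inj h
    exact Subtype.ext (Prod.ext h2.1 (Subtype.ext h2.2))

lemma finite_genus_lt (k : ℕ) : {q : ConnPair d | q.genus < k}.Finite := by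
  refine (finite_connPair_length_le (2 * k + d + d)).subset fun q (hq : q.genus < k) => ?_
  have h1 := q.genus_spec
  have h2 := card_parts_le q.types.1
  have h3 := card_parts_le q.types.2
  show q.1.2.1.length ≤ _
  omega

lemma summable_of_genus_lt (k : ℕ) {f : ConnPair d → ℂ} (hf : ∀ q, k ≤ q.genus → f q = 0) :
    Summable f :=
  summable_of_hasFiniteSupport ((finite_genus_lt k).subset fun q hq => by
    by_contra h
    exact hq (hf q (not_lt.1 h)))

open Classical in
lemma natCast_card_subtype {ι : Type} (P : ι → Prop) :
    (Nat.card {c // P c} : ℂ) = ∑' c, if P c then 1 else 0 := by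
  have h := tsum_subtype {c | P c} fun _ => (1 : ℂ)
  rw [tsum_const, nsmul_one] at h
  refine h.trans (tsum_congr fun c => ?_)
  rw [Set.indicator_apply]
  rfl

lemma hg_eq_tsum (hd : 1 ≤ d) (g : ℕ) (α β : d.Partition) :
    (Hg d g α β : ℂ) =
      ∑' q : ConnPair d, if q.genus = g ∧ q.types = (α, β) then 1 else 0 := by
  classical
  rw [Hg, hr_eq_card_connTuple, card_connTuple, natCast_card_subtype]
  refine tsum_congr fun q => ?_
  congr 1
  rw [hasCycleType_iff, hasCycleType_iff, Prod.ext_iff, eq_comm (a := q.types.1),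
    eq_comm (a := q.types.2), eq_iff_iff]
  refine ⟨fun ⟨h1, h2, h3⟩ => ⟨?_, h2, h3⟩, fun ⟨h1, h2, h3⟩ => ⟨?_, h2, h3⟩⟩
  all_goals
    have h4 := q.genus_spec
    have h5 : α = q.types.1 := h2
    have h6 : β = q.types.2 := h3
    have h7 := card_parts_pos hd α
    have h8 := card_parts_pos hd β
    rw [← h5, ← h6] at h4
    omega

lemma cseq_eq_tsum (hd : 1 ≤ d) (g : ℕ) (Φ Ψ : ℕ → ℂ) :
    Cseq g d Φ Ψ =
      ∑' q : ConnPair d, if q.genus = g then typeWeight Φ Ψ q.types else 0 := by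
  have h1 : Cseq g d Φ Ψ = ∑ p : d.Partition × d.Partition, ∑' q : ConnPair d,
      (if q.genus = g ∧ q.types = p then 1 else 0) * typeWeight Φ Ψ p := by
    rw [Fintype.sum_prod_type]
    refine Finset.sum_congr rfl fun α _ => Finset.sum_congr rfl fun β _ => ?_
    rw [tsum_mul_right, ← hg_eq_tsum hd, typeWeight]
    ring
  rw [h1, ← Summable.tsum_finsetSum]
  · refine tsum_congr fun q => ?_
    rw [Finset.sum_eq_single q.types]
    · simp
    · intro p _ hp
      rw [if_neg fun h => hp h.2.symm, zero_mul]
    · simp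
  · intro p _
    refine summable_of_genus_lt (g + 1) fun q hq => ?_
    rw [if_neg (by omega), zero_mul]

lemma sum_cseq_eq_tsum (hd : 1 ≤ d) (h : ℕ) (Φ Ψ : ℕ → ℂ) (x : ℂ) :
    ∑ g ∈ Finset.range (h + 1), Cseq g d Φ Ψ / x ^ (2 * g) =
      ∑' q : ConnPair d,
        if q.genus < h + 1 then typeWeight Φ Ψ q.types / x ^ (2 * q.genus) else 0 := by
  simp only [cseq_eq_tsum hd, ← tsum_div_const]
  rw [← Summable.tsum_finsetSum]
  · refine tsum_congr fun q => ?_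
    simp only [ite_div, zero_div, Finset.sum_ite_eq, Finset.mem_range]
  · intro g _
    refine summable_of_genus_lt (g + 1) fun q hq => ?_
    rw [if_neg (by omega), zero_div]

lemma permSum_eq_momProd {N : ℕ} (hN : (N : ℂ) ≠ 0) (A : Matrix (Fin N) (Fin N) ℂ)
    (σ : Equiv.Perm (Fin d)) :
    permSum (fun _ => A) σ = (N : ℂ) ^ (cyclePartition σ).parts.card *
      momProd (fun k => (N : ℂ)⁻¹ * (A ^ k).trace) (cyclePartition σ) := by
  rw [permSum_eq_prod, momProd, Multiset.prod_map_mul, Multiset.map_const', Multiset.prod_replicate,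
    ← mul_assoc, ← mul_pow, mul_inv_cancel₀ hN, one_pow, one_mul]
  rfl

lemma iteratedDeriv_freeEnergy_eq_tsum {N : ℕ} (μ : Measure (unitaryGroup (Fin N) ℂ))
    [IsProbabilityMeasure μ] [μ.IsMulLeftInvariant] (A B : Matrix (Fin N) (Fin N) ℂ)
    {ε : ℝ} {F : ℂ → ℂ} (hF : IsFreeEnergyBranch μ A B ε F) (hε : 0 < ε)
    (hd : 1 ≤ d) (hN : d ^ 2 < N) :
    iteratedDeriv d F 0 = ∑' q : ConnPair d,
      typeWeight (fun k => (N : ℂ)⁻¹ * (A ^ k).trace) (fun k => (N : ℂ)⁻¹ * (B ^ k).trace) q.types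
        / (N : ℂ) ^ (2 * q.genus) := by
  obtain ⟨n, rfl⟩ := Nat.exists_eq_add_of_le' hd
  have hN0 : (N : ℂ) ≠ 0 := by exact_mod_cast (by omega : N ≠ 0)
  have h1 := iteratedDeriv_freeEnergy μ A B hF hε n hN
  refine mul_left_cancel₀ (pow_ne_zero 2 hN0) (h1.trans ?_)
  rw [connSeries, ← tsum_mul_left, ← tsum_mul_left]
  refine tsum_congr fun q => ?_
  have h2 := ConnPair.genus_spec q
  rw [wordWeight, permSum_eq_momProd hN0, permSum_eq_momProd hN0, typeWeight]
  change _ * (_ * (_ ^ (ConnPair.types q).1.parts.card * momProd _ (ConnPair.types q).1) *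
    (_ ^ (ConnPair.types q).2.parts.card * momProd _ (ConnPair.types q).2)) = _
  generalize (ConnPair.types q).1.parts.card = a at *
  generalize (ConnPair.types q).2.parts.card = b at *
  generalize q.1.2.1.length = l at *
  generalize ConnPair.genus q = g at *
  have h3 : (-1 : ℂ) ^ l = (-1) ^ a * (-1) ^ b := by
    have := congrArg (fun k => (-1 : ℂ) ^ k) h2
    simpa [pow_add, pow_mul] using this
  have h4 : (N : ℂ) ^ l * (N : ℂ) ^ 2 = (N : ℂ) ^ (2 * g) * (N : ℂ) ^ a * (N : ℂ) ^ b := by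
    rw [← pow_add, h2, pow_add, pow_add]
  rw [neg_pow (N : ℂ)⁻¹, inv_pow, h3, pow_add _ _ b, pow_add _ _ a, mul_div_assoc',
    eq_div_iff (pow_ne_zero _ hN0)]
  refine mul_left_cancel₀ (pow_ne_zero l hN0) ?_
  generalize momProd _ (ConnPair.types q).1 = x
  generalize momProd _ (ConnPair.types q).2 = y
  have h5 : (N : ℂ) ^ l * ((N : ℂ) ^ l)⁻¹ = 1 := mul_inv_cancel₀ (pow_ne_zero _ hN0)
  linear_combination (-1 : ℂ) ^ (n + 1) * (-1) ^ a * (-1) ^ b * x * y *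
    ((N : ℂ) ^ (2 * g) * (N : ℂ) ^ a * (N : ℂ) ^ b * h5 - h4)

lemma summable_inv_pow_genus {m : ℕ} (hm : d ^ 2 < m) :
    Summable fun q : ConnPair d => ((m : ℝ) ^ (2 * q.genus))⁻¹ := by
  have hm1 : (1 : ℝ) ≤ m := by exact_mod_cast (by omega : 1 ≤ m)
  have h1 := summable_length_pow (Fin.val : Fin d → ℕ) (m : ℝ)⁻¹ (by positivity) (by
    rw [Fintype.card_fin, ← div_eq_mul_inv, div_lt_one (by positivity)]
    exact_mod_cast hm)
  have h2 : Summable fun q : ConnPair d => (m : ℝ)⁻¹ ^ q.1.2.1.length := h1.subtype _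
  refine Summable.of_nonneg_of_le (fun _ => by positivity) (fun q => ?_)
    (h2.mul_left ((m : ℝ) ^ (d + d)))
  have h3 := q.genus_spec
  have h4 := card_parts_le q.types.1
  have h5 := card_parts_le q.types.2
  rw [inv_pow, ← div_eq_mul_inv, le_div_iff₀ (by positivity), ← div_eq_inv_mul,
    div_le_iff₀ (by positivity), ← pow_add]
  exact pow_le_pow_right₀ hm1 (by omega)

lemma summable_typeWeight_div {m : ℕ} (hm : d ^ 2 < m) (Φ Ψ : ℕ → ℂ) :
    Summable fun q : ConnPair d => typeWeight Φ Ψ q.types / (m : ℂ) ^ (2 * q.genus) := by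
  obtain ⟨K, hK⟩ := (Set.finite_range fun p : d.Partition × d.Partition =>
    ‖typeWeight Φ Ψ p‖).bddAbove
  refine Summable.of_norm_bounded ((summable_inv_pow_genus hm).mul_left K) fun q => ?_
  rw [norm_div, norm_pow, Complex.norm_natCast, div_eq_mul_inv]
  exact mul_le_mul_of_nonneg_right (hK ⟨_, rfl⟩) (by positivity)

lemma ConvergesFast.typeWeight {h : ℕ} {u v : ℕ → ℕ → ℂ} {Φ Ψ : ℕ → ℂ}
    (hu : ∀ k, 1 ≤ k → ConvergesFast h (fun N => u N k) (Φ k))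
    (hv : ∀ k, 1 ≤ k → ConvergesFast h (fun N => v N k) (Ψ k)) (p : d.Partition × d.Partition) :
    ConvergesFast h (fun N => HCIZ.typeWeight (u N) (v N) p) (HCIZ.typeWeight Φ Ψ p) :=
  ((convergesFast_const h _).mul
    (ConvergesFast.multiset_prod _ fun k hk => hu k (p.1.parts_pos hk))).mul
    (ConvergesFast.multiset_prod _ fun k hk => hv k (p.2.parts_pos hk))

end Genus

/-- Asymptotics of the derivatives of the HCIZ free energy for `(M,h)`-regular
sequences: `F_N^{(d)}(0) = ∑_{g=0}^h C_{g,d}(Φ,Ψ)/N^{2g} + o(N^{-2h})`. -/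
theorem asymptotic_derivatives (M : ℝ) (hM : 0 ≤ M) (h : ℕ) (Φ Ψ : ℕ → ℂ)
    (A B : ∀ N : ℕ, Matrix (Fin N) (Fin N) ℂ)
    (hAnormal : ∀ N, IsStarNormal (A N)) (hBnormal : ∀ N, IsStarNormal (B N))
    (hAbd : ∀ N, opNorm (A N) ≤ M) (hBbd : ∀ N, opNorm (B N) ≤ M)
    (hAmom : ∀ k : ℕ, 1 ≤ k → Filter.Tendsto
      (fun N : ℕ => (N : ℂ) ^ (2 * h) * ((N : ℂ)⁻¹ * ((A N) ^ k).trace - Φ k))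
      Filter.atTop (nhds 0))
    (hBmom : ∀ k : ℕ, 1 ≤ k → Filter.Tendsto
      (fun N : ℕ => (N : ℂ) ^ (2 * h) * ((N : ℂ)⁻¹ * ((B N) ^ k).trace - Ψ k))
      Filter.atTop (nhds 0))
    (μ : ∀ N : ℕ, Measure (Matrix.unitaryGroup (Fin N) ℂ))
    (hμ : ∀ N, (μ N).IsHaarMeasure) (hμprob : ∀ N, IsProbabilityMeasure (μ N))
    (ε : ℕ → ℝ) (hε : ∀ N, 0 < ε N)
    (F : ℕ → ℂ → ℂ) (hF : ∀ N, IsFreeEnergyBranch (μ N) (A N) (B N) (ε N) (F N))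
    (d : ℕ) (hd : 1 ≤ d) :
    Filter.Tendsto (fun N : ℕ => (N : ℂ) ^ (2 * h) *
        (iteratedDeriv d (F N) 0 -
          ∑ g ∈ Finset.range (h + 1), Cseq g d Φ Ψ / (N : ℂ) ^ (2 * g)))
      Filter.atTop (nhds 0) := by
  have hs := summable_inv_pow_genus (Nat.lt_succ_self (d ^ 2))
  have key := tendsto_tsum_of_convergesFast h ConnPair.types ConnPair.genus
    (fun N => typeWeight (fun k => (N : ℂ)⁻¹ * (A N ^ k).trace)
      fun k => (N : ℂ)⁻¹ * (B N ^ k).trace) (typeWeight Φ Ψ)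
    (ConvergesFast.typeWeight hAmom hBmom) (Nat.le_add_left 1 _) hs
  refine key.congr' ?_
  filter_upwards [Filter.eventually_gt_atTop (d ^ 2)] with N hN
  rw [iteratedDeriv_freeEnergy_eq_tsum (μ N) (A N) (B N) (hF N) (hε N) hd hN,
    sum_cseq_eq_tsum hd, tsum_mul_left, Summable.tsum_sub]
  · exact summable_typeWeight_div hN _ _
  · exact summable_of_genus_lt (h + 1) fun q hq => if_neg (by omega)

end HCIZ
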